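/- arXiv:1903.05869 — 5 statements merged into one kernel-verified Lean document; each statement's English description precedes it below -/
import Mathlib

section
/- Let p : [0,1] → [1,∞] be Lebesgue measurable and let f : ℝ → X be Stepanov p(x)-almost periodic. Then f is Stepanov p(x)-almost automorphic. -/
open MeasureTheory Filter Topology Set
open scoped ENNReal

noncomputable section

/-- φ_{p(x)}(t): t^{p(x)} if p(x) < ∞; if p(x) = ∞ then 0 for t ≤ 1 and ∞ for t > 1. -/
def phiVar (p : ℝ → ℝ≥0∞) (x : ℝ) (t : ℝ) : ℝ≥0∞ :=
  if p x ≠ ∞ then ENNReal.ofReal (t ^ (p x).toReal)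
  else if t ≤ 1 then 0 else ∞

/-- ρ(u) := ∫_{[0,1]} φ_{p(x)}(u(x)) dx, for a scalar (norm-valued) function u. -/
def rhoVar (p : ℝ → ℝ≥0∞) (u : ℝ → ℝ) : ℝ≥0∞ :=
  ∫⁻ x in Set.Icc (0:ℝ) 1, phiVar p x (u x)

/-- Membership in L^{p(x)}([0,1]:E). -/
def MemLpVar {E : Type*} [NormedAddCommGroup E] (p : ℝ → ℝ≥0∞) (f : ℝ → E) : Prop :=
  AEStronglyMeasurable f (volume.restrict (Set.Icc (0:ℝ) 1)) ∧
    ∃ c : ℝ, 0 < c ∧ rhoVar p (fun x => c * ‖f x‖) < ∞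

/-- The Luxemburg norm of f in L^{p(x)}([0,1]:E). -/
def luxNorm {E : Type*} [NormedAddCommGroup E] (p : ℝ → ℝ≥0∞) (f : ℝ → E) : ℝ :=
  sInf {lam : ℝ | 0 < lam ∧ rhoVar p (fun x => ‖f x‖ / lam) ≤ 1}

/-- Stepanov p(x)-boundedness on the interval I. -/
def SBdd {E : Type*} [NormedAddCommGroup E] (p : ℝ → ℝ≥0∞) (I : Set ℝ) (f : ℝ → E) : Prop :=
  (∀ t ∈ I, MemLpVar p (fun x => f (t + x))) ∧
    BddAbove ((fun t => luxNorm p (fun x => f (t + x))) '' I)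

/-- The Stepanov norm ‖f‖_{S^{p(x)}} on the interval I. -/
def SNorm {E : Type*} [NormedAddCommGroup E] (p : ℝ → ℝ≥0∞) (I : Set ℝ) (f : ℝ → E) : ℝ :=
  sSup ((fun t => luxNorm p (fun x => f (t + x))) '' I)

/-- Stepanov p(x)-almost automorphy (AAS^{p(x)}(ℝ:E)). -/
def AASVar {E : Type*} [NormedAddCommGroup E] (p : ℝ → ℝ≥0∞) (f : ℝ → E) : Prop :=
  SBdd p Set.univ f ∧
    ∀ a : ℕ → ℝ, ∃ n : ℕ → ℕ, StrictMono n ∧ ∃ g : ℝ → E, SBdd p Set.univ g ∧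
      ∀ t : ℝ,
        Tendsto (fun k => luxNorm p (fun x => f (a (n k) + t + x) - g (t + x))) atTop (𝓝 0) ∧
        Tendsto (fun k => luxNorm p (fun x => g (t - a (n k) + x) - f (t + x))) atTop (𝓝 0)

/-- The class S_0^{p(x)}([0,∞):E) of Stepanov vanishing functions. -/
def S0Var {E : Type*} [NormedAddCommGroup E] (p : ℝ → ℝ≥0∞) (f : ℝ → E) : Prop :=
  SBdd p (Set.Ici 0) f ∧ Tendsto (fun t => luxNorm p (fun x => f (t + x))) atTop (𝓝 0)

/-- Asymptotic Stepanov p(x)-almost automorphy (AAAS^{p(x)}([0,∞):E)). -/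
def AAASVar {E : Type*} [NormedAddCommGroup E] (p : ℝ → ℝ≥0∞) (f : ℝ → E) : Prop :=
  SBdd p (Set.Ici 0) f ∧
    ∃ g q : ℝ → E, AASVar p g ∧ SBdd p (Set.Ici 0) q ∧
      (∀ t : ℝ, 0 ≤ t → f t = g t + q t) ∧
      Tendsto (fun t => luxNorm p (fun x => q (t + x))) atTop (𝓝 0)

/-- Stepanov p(x)-almost periodicity on I: the map t ↦ f(t+·) is Bohr almost periodic
from I to L^{p(x)}([0,1]:E), i.e. continuous plus the relative density of ε-periods. -/
def APSVar {E : Type*} [NormedAddCommGroup E] (p : ℝ → ℝ≥0∞) (I : Set ℝ) (f : ℝ → E) : Prop :=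
  SBdd p I f ∧
    (∀ t ∈ I, Tendsto (fun s => luxNorm p (fun x => f (s + x) - f (t + x))) (𝓝[I] t) (𝓝 0)) ∧
    ∀ ε : ℝ, 0 < ε → ∃ l : ℝ, 0 < l ∧ ∀ a : ℝ, Set.Icc a (a + l) ⊆ I →
      ∃ τ ∈ Set.Icc a (a + l), ∀ t ∈ I, luxNorm p (fun x => f (t + τ + x) - f (t + x)) ≤ ε

/-- Almost automorphic function ℝ → E. -/
def AlmostAutomorphic {E : Type*} [NormedAddCommGroup E] (f : ℝ → E) : Prop :=
  Continuous f ∧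
    ∀ b : ℕ → ℝ, ∃ n : ℕ → ℕ, StrictMono n ∧ ∃ g : ℝ → E,
      (∀ t : ℝ, Tendsto (fun k => f (t + b (n k))) atTop (𝓝 (g t))) ∧
      (∀ t : ℝ, Tendsto (fun k => g (t - b (n k))) atTop (𝓝 (f t)))

/-- Compactly almost automorphic function ℝ → E. -/
def CompactAA {E : Type*} [NormedAddCommGroup E] (f : ℝ → E) : Prop :=
  Continuous f ∧
    ∀ b : ℕ → ℝ, ∃ n : ℕ → ℕ, StrictMono n ∧ ∃ g : ℝ → E,
      (∀ K : Set ℝ, IsCompact K →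
        TendstoUniformlyOn (fun k t => f (t + b (n k))) g atTop K) ∧
      (∀ K : Set ℝ, IsCompact K →
        TendstoUniformlyOn (fun k t => g (t - b (n k))) f atTop K)

/-- Two-parameter Stepanov p(x)-almost automorphy (AAS^{p(x)}(ℝ×F:E)). -/
def AAS2Var {E F : Type*} [NormedAddCommGroup E] [NormedAddCommGroup F]
    (p : ℝ → ℝ≥0∞) (f : ℝ → F → E) : Prop :=
  (∀ y : F, SBdd p Set.univ (fun t => f t y)) ∧
    ∀ a : ℕ → ℝ, ∃ n : ℕ → ℕ, StrictMono n ∧ ∃ g : ℝ → F → E,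
      (∀ y : F, SBdd p Set.univ (fun t => g t y)) ∧
      ∀ (t : ℝ) (y : F),
        Tendsto (fun k => luxNorm p (fun x => f (t + a (n k) + x) y - g (t + x) y)) atTop (𝓝 0) ∧
        Tendsto (fun k => luxNorm p (fun x => g (t - a (n k) + x) y - f (t + x) y)) atTop (𝓝 0)


section bochner_part
open scoped BoundedContinuousFunction

lemma bochner_complete {Y : Type*} [PseudoMetricSpace Y] [CompleteSpace Y] (F : ℝ → Y)
    (hc : Continuous F) (C : ℝ) (hC : ∀ s t, dist (F s) (F t) ≤ C)
    (hap : ∀ ε : ℝ, 0 < ε → ∃ l : ℝ, 0 < l ∧ ∀ a : ℝ, ∃ τ ∈ Set.Icc a (a + l),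
      ∀ t, dist (F (t + τ)) (F t) ≤ ε) (a : ℕ → ℝ) :
    ∃ n : ℕ → ℕ, StrictMono n ∧ ∀ ε : ℝ, 0 < ε → ∃ N, ∀ k ≥ N, ∀ m ≥ N, ∀ t,
      dist (F (a (n k) + t)) (F (a (n m) + t)) < ε := by
  have huc : ∀ ε : ℝ, 0 < ε → ∃ δ : ℝ, 0 < δ ∧ ∀ r h : ℝ, |h| < δ → dist (F (r + h)) (F r) ≤ ε := by
    intro ε hε
    obtain ⟨l, hl, H⟩ := hap (ε/3) (by positivity)
    have hK : IsCompact (Icc (-1:ℝ) (l+1)) := isCompact_Icc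
    have h1 := hK.uniformContinuousOn_of_continuous hc.continuousOn
    rw [Metric.uniformContinuousOn_iff] at h1
    obtain ⟨δ, hδ, h2⟩ := h1 (ε/3) (by positivity)
    refine ⟨min δ 1, by positivity, fun r h hh => ?_⟩
    obtain ⟨τ, hτ, h3⟩ := H (-r)
    have ha : |h| < δ := lt_of_lt_of_le hh (min_le_left _ _)
    have hb : |h| < 1 := lt_of_lt_of_le hh (min_le_right _ _)
    rw [abs_lt] at hb
    have h4 := h3 r
    have h5 := h3 (r + h)
    have h6 := h2 (r + h + τ) ⟨by linarith [hτ.1], by linarith [hτ.2]⟩ (r + τ)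
      ⟨by linarith [hτ.1], by linarith [hτ.2]⟩ (by
        rw [Real.dist_eq]; convert ha using 2; ring)
    have h7 := dist_triangle4 (F (r+h)) (F (r+h+τ)) (F (r+τ)) (F r)
    rw [dist_comm (F (r+h)) (F (r+h+τ))] at h7
    linarith
  let G : ℝ → (ℝ →ᵇ Y) := fun s => BoundedContinuousFunction.mkOfBound
    ⟨fun t => F (s + t), by fun_prop⟩ C (fun x y => hC _ _)
  have hG : ∀ s t, G s t = F (s + t) := fun s t => rfl
  have hGc : Continuous G := by
    rw [Metric.continuous_iff]
    intro b ε hε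
    obtain ⟨δ, hδ, h⟩ := huc (ε/2) (by positivity)
    refine ⟨δ, hδ, fun s hs => ?_⟩
    refine lt_of_le_of_lt ?_ (half_lt_self hε)
    rw [BoundedContinuousFunction.dist_le (by positivity)]
    intro x
    rw [hG, hG]
    have := h (b + x) (s - b) (by rwa [Real.dist_eq] at hs)
    convert this using 3; ring
  have htb : TotallyBounded (range G) := by
    rw [Metric.totallyBounded_iff]
    intro ε hε
    obtain ⟨l, hl, H⟩ := hap (ε/2) (by positivity)
    have hcp : TotallyBounded (G '' Icc 0 l) := (isCompact_Icc.image hGc).totallyBounded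
    rw [Metric.totallyBounded_iff] at hcp
    obtain ⟨t, ht, hcov⟩ := hcp (ε/2) (by positivity)
    refine ⟨t, ht, ?_⟩
    rintro _ ⟨s, rfl⟩
    obtain ⟨τ, hτ, h3⟩ := H (-s)
    have := hcov ⟨s + τ, ⟨by linarith [hτ.1], by linarith [hτ.2]⟩, rfl⟩
    simp only [mem_iUnion, Metric.mem_ball, exists_prop] at this ⊢
    obtain ⟨y, hy, hd⟩ := this
    refine ⟨y, hy, ?_⟩
    have h4 : dist (G (s+τ)) (G s) ≤ ε/2 := by
      rw [BoundedContinuousFunction.dist_le (by positivity)]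
      intro x
      rw [hG, hG]
      convert h3 (s+x) using 3; ring
    have := dist_triangle_left (G s) y (G (s+τ))
    linarith
  have hcpt : IsCompact (closure (range G)) := htb.closure.isCompact_of_isClosed isClosed_closure
  obtain ⟨u, -, n, hn, hu⟩ := hcpt.tendsto_subseq (x := fun k => G (a k))
    (fun k => subset_closure ⟨_, rfl⟩)
  refine ⟨n, hn, fun ε hε => ?_⟩
  have hca := hu.cauchySeq
  rw [Metric.cauchySeq_iff] at hca
  obtain ⟨N, hN⟩ := hca ε hε
  exact ⟨N, fun k hk m hm t => lt_of_le_of_lt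
    (BoundedContinuousFunction.dist_coe_le_dist (f := G (a (n k))) (g := G (a (n m))) t) (hN k hk m hm)⟩

lemma bochner {Y : Type*} [PseudoMetricSpace Y] (F : ℝ → Y)
    (hc : Continuous F) (C : ℝ) (hC : ∀ s t, dist (F s) (F t) ≤ C)
    (hap : ∀ ε : ℝ, 0 < ε → ∃ l : ℝ, 0 < l ∧ ∀ a : ℝ, ∃ τ ∈ Set.Icc a (a + l),
      ∀ t, dist (F (t + τ)) (F t) ≤ ε) (a : ℕ → ℝ) :
    ∃ n : ℕ → ℕ, StrictMono n ∧ ∀ ε : ℝ, 0 < ε → ∃ N, ∀ k ≥ N, ∀ m ≥ N, ∀ t,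
      dist (F (a (n k) + t)) (F (a (n m) + t)) < ε := by
  have := bochner_complete (fun t => (F t : UniformSpace.Completion Y))
    ((UniformSpace.Completion.continuous_coe Y).comp hc) C
    (by simpa [UniformSpace.Completion.dist_eq] using hC)
    (by simpa only [UniformSpace.Completion.dist_eq] using hap) a
  simpa only [UniformSpace.Completion.dist_eq] using this

end bochner_part

section helpers

variable {E : Type*} [NormedAddCommGroup E] {p : ℝ → ℝ≥0∞}

lemma phi_mono (x : ℝ) {s t : ℝ} (hs : 0 ≤ s) (hst : s ≤ t) : phiVar p x s ≤ phiVar p x t := by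
  unfold phiVar
  split_ifs with h1 h2 h3
  · exact ENNReal.ofReal_le_ofReal (Real.rpow_le_rpow hs hst ENNReal.toReal_nonneg)
  · exact le_rfl
  · exact zero_le
  · exact absurd (hst.trans ‹_›) h2
  · exact le_rfl

lemma one_le_toReal {x : ℝ} (hx : 1 ≤ p x) (h : p x ≠ ∞) : 1 ≤ (p x).toReal := by
  have := ENNReal.toReal_mono h hx
  simpa using this

lemma phi_convex {x : ℝ} (hx : 1 ≤ p x) {a b s t : ℝ} (hs : 0 ≤ s) (ht : 0 ≤ t)
    (ha : 0 ≤ a) (hb : 0 ≤ b) (hab : a + b = 1) :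
    phiVar p x (a * s + b * t) ≤ ENNReal.ofReal a * phiVar p x s + ENNReal.ofReal b * phiVar p x t := by
  unfold phiVar
  by_cases h : p x ≠ ∞
  · simp only [if_pos h]
    rw [← ENNReal.ofReal_mul ha, ← ENNReal.ofReal_mul hb, ← ENNReal.ofReal_add (by positivity)
      (by positivity)]
    apply ENNReal.ofReal_le_ofReal
    simpa using (convexOn_rpow (one_le_toReal hx h)).2 hs ht ha hb hab
  · simp only [if_neg h]
    rcases ha.eq_or_lt with rfl | ha
    · have : b = 1 := by linarith
      subst this; simp
    rcases hb.eq_or_lt with rfl | hb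
    · have : a = 1 := by linarith
      subst this; simp
    by_cases h1 : s ≤ 1
    · by_cases h2 : t ≤ 1
      · rw [if_pos (by nlinarith)]; exact zero_le
      · rw [if_neg h2, ENNReal.mul_top (by simpa using hb)]; simp
    · rw [if_neg h1, ENNReal.mul_top (by simpa using ha)]; simp

lemma phi_zero {x : ℝ} (hx : 1 ≤ p x) : phiVar p x 0 = 0 := by
  unfold phiVar
  split_ifs with h1 h2
  · rw [Real.zero_rpow (by linarith [one_le_toReal hx h1])]; simp
  · rfl
  · norm_num at h2

lemma le_one_add_phi {x : ℝ} (hx : 1 ≤ p x) (t : ℝ) :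
    ENNReal.ofReal t ≤ 1 + phiVar p x t := by
  by_cases h1 : t ≤ 1
  · exact (ENNReal.ofReal_le_ofReal h1).trans (by simp)
  · refine le_trans ?_ le_add_self
    unfold phiVar
    split_ifs with h
    · apply ENNReal.ofReal_le_ofReal
      exact Real.self_le_rpow_of_one_le (le_of_not_ge h1) (one_le_toReal hx h)
    · exact le_top

lemma phi_meas (hp : Measurable p) : Measurable (fun z : ℝ × ℝ => phiVar p z.1 z.2) := by
  unfold phiVar
  refine Measurable.ite ?_ ?_ (Measurable.ite ?_ measurable_const measurable_const)
  · exact (hp.comp measurable_fst) (measurableSet_singleton ∞).compl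
  · exact (measurable_snd.pow ((hp.comp measurable_fst).ennreal_toReal)).ennreal_ofReal
  · exact measurableSet_le measurable_snd measurable_const

lemma phi_aem (hp : Measurable p) {μ : Measure ℝ} {u : ℝ → ℝ} (hu : AEMeasurable u μ) :
    AEMeasurable (fun x => phiVar p x (u x)) μ :=
  (phi_meas hp).comp_aemeasurable (aemeasurable_id.prodMk hu)

lemma phi_lsc {x : ℝ} {u : ℕ → ℝ} {v : ℝ}
    (h : Tendsto u atTop (𝓝 v)) :
    phiVar p x v ≤ liminf (fun k => phiVar p x (u k)) atTop := by
  unfold phiVar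
  by_cases hp : p x ≠ ∞
  · simp only [if_pos hp]
    refine le_of_eq (Tendsto.liminf_eq ?_).symm
    exact ENNReal.tendsto_ofReal (h.rpow_const (Or.inr ENNReal.toReal_nonneg))
  · simp only [if_neg hp]
    split_ifs with h1
    · exact zero_le
    · refine le_of_eq (Tendsto.liminf_eq ?_).symm
      refine tendsto_const_nhds.congr' ?_
      filter_upwards [h.eventually (lt_mem_nhds (not_le.mp h1))] with k hk
      rw [if_neg (not_le.mpr hk)]

/-- the modular unit-ball condition at scale lam -/
def InB (p : ℝ → ℝ≥0∞) (lam : ℝ) (u : ℝ → E) : Prop :=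
  0 < lam ∧ rhoVar p (fun x => ‖u x‖ / lam) ≤ 1

local notation "μ₀" => volume.restrict (Set.Icc (0:ℝ) 1)

lemma InB.lux_le {lam : ℝ} {u : ℝ → E} (h : InB p lam u) : luxNorm p u ≤ lam :=
  csInf_le ⟨0, fun _ hx => hx.1.le⟩ h

lemma lux_nonneg (u : ℝ → E) : 0 ≤ luxNorm p u :=
  Real.sInf_nonneg fun _ hx => hx.1.le

lemma InB.mono {lam mu : ℝ} {u : ℝ → E} (h : InB p lam u) (hm : lam ≤ mu) : InB p mu u := by
  refine ⟨h.1.trans_le hm, le_trans (lintegral_mono fun x => ?_) h.2⟩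
  have h1 := h.1
  have h2 := h1.trans_le hm
  apply phi_mono
  · positivity
  · exact div_le_div_of_nonneg_left (norm_nonneg _) h1 hm

lemma InB.of_lux_lt {lam : ℝ} {u : ℝ → E} (h : ∃ m, InB p m u) (hl : luxNorm p u < lam) :
    InB p lam u := by
  obtain ⟨m, hm, hml⟩ := exists_lt_of_csInf_lt h hl
  exact InB.mono hm hml.le

lemma InB.mem {lam : ℝ} {u : ℝ → E} (h : InB p lam u) (hu : AEStronglyMeasurable u μ₀) :
    MemLpVar p u := by
  refine ⟨hu, lam⁻¹, inv_pos.2 h.1, lt_of_le_of_lt ?_ ENNReal.one_lt_top⟩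
  have := h.2
  simp only [div_eq_inv_mul] at this
  exact this

lemma InB.add (hpm : Measurable p) (hp1 : ∀ x ∈ Set.Icc (0:ℝ) 1, 1 ≤ p x) {lam mu : ℝ}
    {u v : ℝ → E} (hu : InB p lam u) (hv : InB p mu v) (hum : AEStronglyMeasurable u μ₀) :
    InB p (lam + mu) (fun x => u x + v x) := by
  have hl := hu.1
  have hm := hv.1
  refine ⟨by positivity, ?_⟩
  have key : rhoVar p (fun x => ‖u x + v x‖ / (lam + mu)) ≤
      ∫⁻ x in Set.Icc (0:ℝ) 1, (ENNReal.ofReal (lam / (lam + mu)) * phiVar p x (‖u x‖ / lam)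
        + ENNReal.ofReal (mu / (lam + mu)) * phiVar p x (‖v x‖ / mu)) := by
    refine setLIntegral_mono' measurableSet_Icc fun x hx => ?_
    refine le_trans ?_ (phi_convex (hp1 x hx) (by positivity) (by positivity) (by positivity)
      (by positivity) (by field_simp))
    apply phi_mono
    · positivity
    · have : lam / (lam + mu) * (‖u x‖ / lam) + mu / (lam + mu) * (‖v x‖ / mu)
        = (‖u x‖ + ‖v x‖) / (lam + mu) := by field_simp
      rw [this]
      exact div_le_div_of_nonneg_right (norm_add_le _ _) (by positivity)
  refine key.trans ?_
  rw [lintegral_add_left' ((phi_aem hpm (hum.norm.aemeasurable.div_const _)).const_mul _),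
    lintegral_const_mul' _ _ ENNReal.ofReal_ne_top, lintegral_const_mul' _ _ ENNReal.ofReal_ne_top]
  calc _ ≤ ENNReal.ofReal (lam / (lam + mu)) * 1 + ENNReal.ofReal (mu / (lam + mu)) * 1 := by
        gcongr
        · exact hu.2
        · exact hv.2
    _ = 1 := by
        rw [mul_one, mul_one, ← ENNReal.ofReal_add (by positivity) (by positivity)]
        have : lam / (lam + mu) + mu / (lam + mu) = 1 := by field_simp
        rw [this]; simp

lemma MemLpVar.exInB (hp1 : ∀ x ∈ Set.Icc (0:ℝ) 1, 1 ≤ p x) {u : ℝ → E} (h : MemLpVar p u) :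
    ∃ m, InB p m u := by
  obtain ⟨-, c, hc, hr⟩ := h
  set R := (rhoVar p (fun x => c * ‖u x‖)).toReal with hR
  have hR0 : 0 ≤ R := ENNReal.toReal_nonneg
  refine ⟨(R + 1) / c, by positivity, ?_⟩
  have key : rhoVar p (fun x => ‖u x‖ / ((R + 1) / c)) ≤
      ∫⁻ x in Set.Icc (0:ℝ) 1, ENNReal.ofReal (1 / (R + 1)) * phiVar p x (c * ‖u x‖) := by
    refine setLIntegral_mono' measurableSet_Icc fun x hx => ?_
    have h1 := phi_convex (hp1 x hx) (a := 1 / (R+1)) (b := R / (R+1)) (s := c * ‖u x‖) (t := 0)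
      (by positivity) le_rfl (by positivity) (by positivity) (by field_simp; ring)
    rw [phi_zero (hp1 x hx)] at h1
    have h2 : 1 / (R+1) * (c * ‖u x‖) + R / (R+1) * 0 = ‖u x‖ / ((R + 1) / c) := by
      field_simp; simp
    rw [h2] at h1
    simpa using h1
  refine key.trans ?_
  rw [lintegral_const_mul' _ _ ENNReal.ofReal_ne_top]
  change ENNReal.ofReal (1 / (R + 1)) * rhoVar p (fun x => c * ‖u x‖) ≤ 1
  rw [← ENNReal.ofReal_toReal hr.ne, ← hR, ← ENNReal.ofReal_mul (by positivity)]
  rw [ENNReal.ofReal_le_one]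
  rw [div_mul_eq_mul_div, div_le_one (by positivity)]; linarith

lemma MemLpVar.neg' {u : ℝ → E} (h : MemLpVar p u) : MemLpVar p (fun x => - u x) :=
  ⟨h.1.neg, by simpa using h.2⟩

lemma InB.neg {lam : ℝ} {u : ℝ → E} (h : InB p lam u) : InB p lam (fun x => - u x) :=
  ⟨h.1, by simpa using h.2⟩

lemma MemLpVar.sub' (hpm : Measurable p) (hp1 : ∀ x ∈ Set.Icc (0:ℝ) 1, 1 ≤ p x)
    {u v : ℝ → E} (hu : MemLpVar p u) (hv : MemLpVar p v) :
    MemLpVar p (fun x => u x - v x) := by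
  obtain ⟨a, ha⟩ := hu.exInB hp1
  obtain ⟨b, hb⟩ := hv.exInB hp1
  have := ha.add hpm hp1 hb.neg hu.1
  simp only [← sub_eq_add_neg] at this
  exact this.mem (hu.1.sub hv.1)

lemma lux_add_le (hpm : Measurable p) (hp1 : ∀ x ∈ Set.Icc (0:ℝ) 1, 1 ≤ p x)
    {u v : ℝ → E} (hu : MemLpVar p u) (hv : MemLpVar p v) :
    luxNorm p (fun x => u x + v x) ≤ luxNorm p u + luxNorm p v := by
  refine le_of_forall_pos_le_add fun ε hε => ?_
  have ha := InB.of_lux_lt (hu.exInB hp1) (show luxNorm p u < luxNorm p u + ε/2 by linarith)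
  have hb := InB.of_lux_lt (hv.exInB hp1) (show luxNorm p v < luxNorm p v + ε/2 by linarith)
  have := (ha.add hpm hp1 hb hu.1).lux_le
  linarith

lemma lux_neg (u : ℝ → E) : luxNorm p (fun x => - u x) = luxNorm p u := by
  simp [luxNorm]

lemma lux_sub_comm (u v : ℝ → E) :
    luxNorm p (fun x => u x - v x) = luxNorm p (fun x => v x - u x) := by
  rw [← lux_neg]; simp

lemma lux_zero (hp1 : ∀ x ∈ Set.Icc (0:ℝ) 1, 1 ≤ p x) : luxNorm p (fun _ => (0:E)) = 0 := by
  refine le_antisymm (le_of_forall_pos_le_add fun ε hε => ?_) (lux_nonneg _)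
  rw [zero_add]
  refine InB.lux_le ⟨hε, ?_⟩
  unfold rhoVar
  rw [setLIntegral_congr_fun (g := fun _ => 0) measurableSet_Icc]
  · simp
  · intro x hx
    simpa using phi_zero (hp1 x hx)

/-- The space L^{p(x)} as a type (before quotienting). -/
def LVar (E : Type*) [NormedAddCommGroup E] (p : ℝ → ℝ≥0∞) : Type _ := {u : ℝ → E // MemLpVar p u}

/-- The pseudometric of L^{p(x)}. -/
@[reducible] def LVar.pm (hpm : Measurable p) (hp1 : ∀ x ∈ Set.Icc (0:ℝ) 1, 1 ≤ p x) :
    PseudoMetricSpace (LVar E p) where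
  dist u v := luxNorm p (fun x => u.1 x - v.1 x)
  dist_self u := by simpa using lux_zero hp1
  dist_comm u v := lux_sub_comm _ _
  dist_triangle u v w := by
    have := lux_add_le hpm hp1 (u.2.sub' hpm hp1 v.2) (v.2.sub' hpm hp1 w.2)
    simpa using this

lemma InB.lintegral_le (hp1 : ∀ x ∈ Set.Icc (0:ℝ) 1, 1 ≤ p x) {lam : ℝ} {u : ℝ → E}
    (h : InB p lam u) : ∫⁻ x in Set.Icc (0:ℝ) 1, ‖u x‖ₑ ≤ ENNReal.ofReal lam * 2 := by
  have hl := h.1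
  have key : ∫⁻ x in Set.Icc (0:ℝ) 1, ‖u x‖ₑ ≤
      ∫⁻ x in Set.Icc (0:ℝ) 1, ENNReal.ofReal lam * (1 + phiVar p x (‖u x‖ / lam)) := by
    refine setLIntegral_mono' measurableSet_Icc fun x hx => ?_
    have h1 := le_one_add_phi (hp1 x hx) (‖u x‖ / lam)
    calc ‖u x‖ₑ = ENNReal.ofReal lam * ENNReal.ofReal (‖u x‖ / lam) := by
          rw [← ENNReal.ofReal_mul hl.le, mul_div_cancel₀ _ hl.ne', ofReal_norm]
      _ ≤ _ := by gcongr
  refine key.trans ?_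
  rw [lintegral_const_mul' _ _ ENNReal.ofReal_ne_top, lintegral_add_left measurable_const]
  gcongr
  have : ∫⁻ x in Set.Icc (0:ℝ) 1, (1:ℝ≥0∞) = 1 := by simp
  rw [this, ← one_add_one_eq_two]
  gcongr
  exact h.2

lemma InB.fatou (hpm : Measurable p) (hp1 : ∀ x ∈ Set.Icc (0:ℝ) 1, 1 ≤ p x) {lam : ℝ}
    {u : ℕ → ℝ → E} {v : ℝ → E} (hl : 0 < lam) (hu : ∀ᶠ k in atTop, InB p lam (u k))
    (hm : ∀ k, AEStronglyMeasurable (u k) μ₀)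
    (hlim : ∀ᵐ x ∂μ₀, Tendsto (fun k => u k x) atTop (𝓝 (v x))) : InB p lam v := by
  refine ⟨hl, ?_⟩
  calc rhoVar p (fun x => ‖v x‖ / lam)
      ≤ ∫⁻ x in Set.Icc (0:ℝ) 1, liminf (fun k => phiVar p x (‖u k x‖ / lam)) atTop := by
        refine lintegral_mono_ae ?_
        filter_upwards [hlim] with x hx
        exact phi_lsc (hx.norm.div_const _)
    _ ≤ liminf (fun k => rhoVar p (fun x => ‖u k x‖ / lam)) atTop :=
        lintegral_liminf_le' fun k => phi_aem hpm ((hm k).norm.aemeasurable.div_const _)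
    _ ≤ 1 := by
        refine (liminf_le_limsup).trans (limsup_le_of_le (by isBoundedDefault) ?_)
        filter_upwards [hu] with k hk using hk.2

lemma ae_lim [CompleteSpace E] (hp1 : ∀ x ∈ Set.Icc (0:ℝ) 1, 1 ≤ p x) {u : ℕ → ℝ → E}
    (hm : ∀ k, AEStronglyMeasurable (u k) μ₀)
    (h : ∀ k, InB p ((1/2)^k) (fun x => u k x - u (k+1) x)) :
    ∀ᵐ x ∂μ₀, ∃ y, Tendsto (fun k => u k x) atTop (𝓝 y) := by
  have hme : ∀ k, AEMeasurable (fun x => ‖u k x - u (k+1) x‖ₑ) μ₀ :=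
    fun k => ((hm k).sub (hm (k+1))).enorm
  have h1 : ∫⁻ x in Set.Icc (0:ℝ) 1, ∑' k, ‖u k x - u (k+1) x‖ₑ ≠ ∞ := by
    rw [lintegral_tsum hme]
    refine ne_top_of_le_ne_top ?_ (ENNReal.tsum_le_tsum fun k => (h k).lintegral_le hp1)
    rw [ENNReal.tsum_mul_right]
    refine ENNReal.mul_ne_top ?_ (by norm_num)
    rw [← ENNReal.ofReal_tsum_of_nonneg (fun k => by positivity) summable_geometric_two]
    exact ENNReal.ofReal_ne_top
  have h2 := ae_lt_top' (AEMeasurable.tsum hme) h1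
  filter_upwards [h2] with x hx
  refine cauchySeq_tendsto_of_complete
    (cauchySeq_of_edist_le_of_tsum_ne_top _ (fun k => ?_) hx.ne)
  rw [edist_eq_enorm_sub]

end helpers

/-- every Stepanov p(x)-almost periodic function ℝ → X is
Stepanov p(x)-almost automorphic. -/
theorem stepanov_px_ap_implies_aa
    {X : Type*} [NormedAddCommGroup X] [NormedSpace ℂ X] [CompleteSpace X]
    (p : ℝ → ℝ≥0∞) (hpmeas : Measurable p) (hp1 : ∀ x ∈ Set.Icc (0:ℝ) 1, 1 ≤ p x)
    (f : ℝ → X) (hf : APSVar p Set.univ f) :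
    AASVar p f := by
  obtain ⟨hb, hcont, hap⟩ := hf
  have hmem : ∀ t, MemLpVar p (fun x => f (t + x)) := fun t => hb.1 t (mem_univ t)
  obtain ⟨C, hC⟩ := hb.2
  have hC' : ∀ t, luxNorm p (fun x => f (t + x)) ≤ C := fun t => hC ⟨t, mem_univ t, rfl⟩
  refine ⟨hb, fun a => ?_⟩
  letI : PseudoMetricSpace (LVar X p) := LVar.pm hpmeas hp1
  let F : ℝ → LVar X p := fun t => ⟨fun x => f (t + x), hmem t⟩
  have hF : ∀ s t, dist (F s) (F t) = luxNorm p (fun x => f (s + x) - f (t + x)) :=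
    fun s t => rfl
  have hFc : Continuous F := by
    rw [continuous_iff_continuousAt]
    intro t
    rw [ContinuousAt, tendsto_iff_dist_tendsto_zero]
    have := hcont t (mem_univ t)
    rw [nhdsWithin_univ] at this
    exact this
  have hFb : ∀ s t, dist (F s) (F t) ≤ C + C := by
    intro s t
    have := lux_add_le hpmeas hp1 (hmem s) (hmem t).neg'
    rw [lux_neg] at this
    rw [hF]
    simp only [sub_eq_add_neg]
    linarith [hC' s, hC' t]
  obtain ⟨n, hn, hN⟩ := bochner F hFc (C + C) hFb (by
    intro ε hε
    obtain ⟨l, hl, h⟩ := hap ε hε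
    refine ⟨l, hl, fun a => ?_⟩
    obtain ⟨τ, hτ, h2⟩ := h a (subset_univ _)
    exact ⟨τ, hτ, fun t => h2 t (mem_univ t)⟩) a
  obtain ⟨φ, hφ, hφ2⟩ := extraction_forall_of_eventually
    (P := fun j k => ∀ k' ≥ k, ∀ t, dist (F (a (n k) + t)) (F (a (n k') + t)) < (1/2:ℝ)^j) (by
    intro j
    obtain ⟨N, h⟩ := hN ((1/2:ℝ)^j) (by positivity)
    filter_upwards [eventually_ge_atTop N] with k hk k' hk' t
    exact h k hk k' (le_trans hk hk') t)
  set b : ℕ → ℝ := fun k => a (n (φ k)) with hbdef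
  have hIB : ∀ j k : ℕ, j ≤ k → ∀ t, InB p ((1/2:ℝ)^j)
      (fun x => f (b j + t + x) - f (b k + t + x)) := by
    intro j k hjk t
    have h1 := hφ2 j (φ k) (hφ.monotone hjk) t
    rw [hF] at h1
    exact InB.of_lux_lt (((hmem _).sub' hpmeas hp1 (hmem _)).exInB hp1) h1
  let g : ℝ → X := fun y => limUnder atTop (fun k => f (b k + y))
  have hlim : ∀ t, ∀ᵐ x ∂(volume.restrict (Set.Icc (0:ℝ) 1)),
      Tendsto (fun k => f (b k + t + x)) atTop (𝓝 (g (t + x))) := by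
    intro t
    have := ae_lim (u := fun k x => f (b k + t + x)) hp1 (fun k => (hmem _).1)
      (fun k => hIB k (k+1) (Nat.le_succ k) t)
    filter_upwards [this] with x hx
    simp only [add_assoc] at hx ⊢
    exact tendsto_nhds_limUnder hx
  have hgm : ∀ t, AEStronglyMeasurable (fun x => g (t + x)) (volume.restrict (Set.Icc (0:ℝ) 1)) :=
    fun t => aestronglyMeasurable_of_tendsto_ae atTop (fun k => (hmem (b k + t)).1) (hlim t)
  have hg : ∀ j t, InB p ((1/2:ℝ)^j) (fun x => f (b j + t + x) - g (t + x)) := by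
    intro j t
    refine InB.fatou (u := fun k x => f (b j + t + x) - f (b k + t + x)) hpmeas hp1
      (by positivity) ?_ (fun k => (hmem _).1.sub (hmem _).1) ?_
    · filter_upwards [eventually_ge_atTop j] with k hk using hIB j k hk t
    · filter_upwards [hlim t] with x hx using tendsto_const_nhds.sub hx
  have hdm : ∀ j t, MemLpVar p (fun x => f (b j + t + x) - g (t + x)) :=
    fun j t => (hg j t).mem ((hmem _).1.sub (hgm t))
  have hpow : Tendsto (fun k : ℕ => (1/2:ℝ)^k) atTop (𝓝 0) :=
    tendsto_pow_atTop_nhds_zero_of_lt_one (by norm_num) (by norm_num)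
  refine ⟨n ∘ φ, hn.comp hφ, g, ⟨fun t _ => ?_, ?_⟩, fun t => ⟨?_, ?_⟩⟩
  · have := (hmem (b 0 + t)).sub' hpmeas hp1 (hdm 0 t)
    simpa using this
  · refine ⟨C + 1, ?_⟩
    rintro _ ⟨t, -, rfl⟩
    have h1 := lux_add_le hpmeas hp1 (hmem (b 0 + t)) (hdm 0 t).neg'
    rw [lux_neg] at h1
    have h2 := (hg 0 t).lux_le
    have h3 := hC' (b 0 + t)
    simp only [neg_sub, add_sub_cancel, pow_zero] at h1 h2
    change luxNorm p (fun x => g (t + x)) ≤ C + 1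
    linarith
  · exact squeeze_zero (fun k => lux_nonneg _) (fun k => (hg k t).lux_le) hpow
  · refine squeeze_zero (fun k => lux_nonneg _) (fun k => ?_) hpow
    have h1 := (hg k (t - b k)).lux_le
    rw [lux_sub_comm] at h1
    simpa using h1

end
end

section
/- Let p : [0,1] → [1,∞) be Lebesgue measurable and let p⁻, p⁺ be real constants with 1 ≤ p⁻ ≤ p(x) ≤ p⁺ < ∞ for a.e. x ∈ [0,1]. Then AAAS^{p⁺}([0,∞):X) ⊆ AAAS^{p(x)}([0,∞):X) ⊆ AAAS^{p⁻}([0,∞):X), and both embeddings are continuous with respect to the corresponding Stepanov norms. -/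
open MeasureTheory Filter Topology Set
open scoped ENNReal

noncomputable section

lemma rhoVar_congr_aux (p : ℝ → ℝ≥0∞) (u : ℝ → ℝ)
    (h : ∀ᵐ x ∂(volume.restrict (Set.Icc (0:ℝ) 1)), 1 ≤ p x ∧ p x ≠ ∞) :
    rhoVar p u = ∫⁻ x in Set.Icc (0:ℝ) 1, ENNReal.ofReal (u x ^ (p x).toReal) := by
  unfold rhoVar
  apply lintegral_congr_ae
  filter_upwards [h] with x hx
  simp [phiVar, hx.2]

lemma toReal_one_le_aux {a : ℝ≥0∞} (h : 1 ≤ a ∧ a ≠ ∞) : 1 ≤ a.toReal := by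
  have := ENNReal.toReal_mono h.2 h.1
  simpa using this

lemma rhoVar_scale_aux (p : ℝ → ℝ≥0∞) (u : ℝ → ℝ) (hu : ∀ x, 0 ≤ u x)
    (h : ∀ᵐ x ∂(volume.restrict (Set.Icc (0:ℝ) 1)), 1 ≤ p x ∧ p x ≠ ∞)
    (K : ℝ) (hK0 : 0 ≤ K) (hK : K ≤ 1) :
    rhoVar p (fun x => K * u x) ≤ ENNReal.ofReal K * rhoVar p u := by
  rw [rhoVar_congr_aux p _ h, rhoVar_congr_aux p _ h,
    ← lintegral_const_mul' _ _ ENNReal.ofReal_ne_top]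
  apply lintegral_mono_ae
  filter_upwards [h] with x hx
  have h1 := toReal_one_le_aux hx
  rw [← ENNReal.ofReal_mul hK0]
  apply ENNReal.ofReal_le_ofReal
  rw [Real.mul_rpow hK0 (hu x)]
  apply mul_le_mul_of_nonneg_right _ (Real.rpow_nonneg (hu x) _)
  rcases hK0.eq_or_lt with h0 | h0
  · rw [← h0, Real.zero_rpow (by linarith)]
  · simpa using Real.rpow_le_rpow_of_exponent_ge h0 hK h1

lemma rhoVar_le_aux (p₁ p₂ : ℝ → ℝ≥0∞) (u : ℝ → ℝ) (hu : ∀ x, 0 ≤ u x)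
    (h₁ : ∀ᵐ x ∂(volume.restrict (Set.Icc (0:ℝ) 1)), 1 ≤ p₁ x ∧ p₁ x ≠ ∞)
    (h₂ : ∀ᵐ x ∂(volume.restrict (Set.Icc (0:ℝ) 1)), 1 ≤ p₂ x ∧ p₂ x ≠ ∞)
    (h : ∀ᵐ x ∂(volume.restrict (Set.Icc (0:ℝ) 1)), p₁ x ≤ p₂ x) :
    rhoVar p₁ u ≤ 1 + rhoVar p₂ u := by
  rw [rhoVar_congr_aux p₁ _ h₁, rhoVar_congr_aux p₂ _ h₂]
  have h3 : (1 : ℝ≥0∞) = ∫⁻ x in Set.Icc (0:ℝ) 1, (1 : ℝ≥0∞) := by simp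
  conv_rhs => rw [h3]
  rw [← lintegral_add_left measurable_const]
  apply lintegral_mono_ae
  filter_upwards [h₁, h₂, h] with x hx1 hx2 hx
  have h4 := toReal_one_le_aux hx1
  have h5 := ENNReal.toReal_mono hx2.2 hx
  rcases le_total (u x) 1 with hl | hl
  · refine le_trans ?_ le_self_add
    rw [← ENNReal.ofReal_one]
    exact ENNReal.ofReal_le_ofReal (Real.rpow_le_one (hu x) hl (by linarith))
  · refine le_trans ?_ le_add_self
    exact ENNReal.ofReal_le_ofReal (Real.rpow_le_rpow_of_exponent_le hl h5)

lemma lux_nonempty_aux {E : Type*} [NormedAddCommGroup E] (p : ℝ → ℝ≥0∞) (f : ℝ → E)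
    (h : ∀ᵐ x ∂(volume.restrict (Set.Icc (0:ℝ) 1)), 1 ≤ p x ∧ p x ≠ ∞)
    (hf : MemLpVar p f) :
    {lam : ℝ | 0 < lam ∧ rhoVar p (fun x => ‖f x‖ / lam) ≤ 1}.Nonempty := by
  obtain ⟨-, c, hc, hfin⟩ := hf
  set M := rhoVar p (fun x => c * ‖f x‖) with hM
  have hM0 : 0 ≤ M.toReal := ENNReal.toReal_nonneg
  have hpos : 0 < 1 + M.toReal := by linarith
  refine ⟨(1 + M.toReal) / c, div_pos hpos hc, ?_⟩
  have key := rhoVar_scale_aux p (fun x => c * ‖f x‖) (fun x => by positivity) h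
    (1 + M.toReal)⁻¹ (by positivity) (inv_le_one_of_one_le₀ (by linarith))
  have e : (fun x => ‖f x‖ / ((1 + M.toReal) / c))
      = fun x => (1 + M.toReal)⁻¹ * (c * ‖f x‖) := by
    funext x
    field_simp
  rw [e]
  refine key.trans ?_
  rw [← hM, ← ENNReal.ofReal_toReal hfin.ne, ← ENNReal.ofReal_mul (by positivity),
    ENNReal.toReal_ofReal hM0, ← ENNReal.ofReal_one]
  apply ENNReal.ofReal_le_ofReal
  rw [inv_mul_le_iff₀ hpos]
  linarith

lemma lux_nonneg_aux {E : Type*} [NormedAddCommGroup E] (p : ℝ → ℝ≥0∞) (f : ℝ → E) :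
    0 ≤ luxNorm p f :=
  Real.sInf_nonneg fun _ hx => hx.1.le

lemma lux_le_aux {E : Type*} [NormedAddCommGroup E] (p₁ p₂ : ℝ → ℝ≥0∞) (f : ℝ → E)
    (h₁ : ∀ᵐ x ∂(volume.restrict (Set.Icc (0:ℝ) 1)), 1 ≤ p₁ x ∧ p₁ x ≠ ∞)
    (h₂ : ∀ᵐ x ∂(volume.restrict (Set.Icc (0:ℝ) 1)), 1 ≤ p₂ x ∧ p₂ x ≠ ∞)
    (h : ∀ᵐ x ∂(volume.restrict (Set.Icc (0:ℝ) 1)), p₁ x ≤ p₂ x)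
    (hf : MemLpVar p₂ f) : luxNorm p₁ f ≤ 2 * luxNorm p₂ f := by
  have hne := lux_nonempty_aux p₂ f h₂ hf
  have : luxNorm p₁ f / 2 ≤ luxNorm p₂ f := by
    apply le_csInf hne
    rintro lam ⟨hl, hr⟩
    have hmem : 2 * lam ∈ {lam : ℝ | 0 < lam ∧ rhoVar p₁ (fun x => ‖f x‖ / lam) ≤ 1} := by
      refine ⟨by positivity, ?_⟩
      have k1 := rhoVar_scale_aux p₁ (fun x => ‖f x‖ / lam) (fun x => by positivity) h₁
        (1/2) (by norm_num) (by norm_num)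
      have k2 := rhoVar_le_aux p₁ p₂ (fun x => ‖f x‖ / lam) (fun x => by positivity) h₁ h₂ h
      have e : (fun x => ‖f x‖ / (2 * lam)) = fun x => (1/2) * (‖f x‖ / lam) := by
        funext x
        field_simp
      rw [e]
      calc _ ≤ _ := k1
        _ ≤ ENNReal.ofReal (1/2) * ENNReal.ofReal 2 := by
            gcongr
            refine k2.trans ((add_le_add_right hr 1).trans ?_)
            rw [one_add_one_eq_two]
            simp
        _ = 1 := by
            rw [← ENNReal.ofReal_mul (by norm_num)]
            norm_num
    have hb : BddBelow {lam : ℝ | 0 < lam ∧ rhoVar p₁ (fun x => ‖f x‖ / lam) ≤ 1} :=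
      ⟨0, fun _ hx => hx.1.le⟩
    have := csInf_le hb hmem
    unfold luxNorm
    linarith
  linarith

lemma mem_mono_aux {E : Type*} [NormedAddCommGroup E] (p₁ p₂ : ℝ → ℝ≥0∞) (f : ℝ → E)
    (h₁ : ∀ᵐ x ∂(volume.restrict (Set.Icc (0:ℝ) 1)), 1 ≤ p₁ x ∧ p₁ x ≠ ∞)
    (h₂ : ∀ᵐ x ∂(volume.restrict (Set.Icc (0:ℝ) 1)), 1 ≤ p₂ x ∧ p₂ x ≠ ∞)
    (h : ∀ᵐ x ∂(volume.restrict (Set.Icc (0:ℝ) 1)), p₁ x ≤ p₂ x)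
    (hf : MemLpVar p₂ f) : MemLpVar p₁ f := by
  obtain ⟨hm, c, hc, hfin⟩ := hf
  refine ⟨hm, c, hc, ?_⟩
  refine (rhoVar_le_aux p₁ p₂ _ (fun x => by positivity) h₁ h₂ h).trans_lt ?_
  exact ENNReal.add_lt_top.2 ⟨ENNReal.one_lt_top, hfin⟩

lemma mem_sub_aux {E : Type*} [NormedAddCommGroup E] (p : ℝ → ℝ≥0∞) (hp : Measurable p)
    (f g : ℝ → E)
    (h : ∀ᵐ x ∂(volume.restrict (Set.Icc (0:ℝ) 1)), 1 ≤ p x ∧ p x ≠ ∞)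
    (hf : MemLpVar p f) (hg : MemLpVar p g) : MemLpVar p (fun x => f x - g x) := by
  obtain ⟨hmf, c, hc, hff⟩ := hf
  obtain ⟨hmg, d, hd, hgf⟩ := hg
  have hmin : 0 < min c d := lt_min hc hd
  refine ⟨hmf.sub hmg, min c d / 2, by positivity, ?_⟩
  rw [rhoVar_congr_aux p _ h] at hff hgf ⊢
  have hmeas : AEMeasurable (fun x => ENNReal.ofReal ((c * ‖f x‖) ^ (p x).toReal))
      (volume.restrict (Set.Icc (0:ℝ) 1)) :=
    (((hmf.norm.aemeasurable).const_mul c).pow hp.ennreal_toReal.aemeasurable).ennreal_ofReal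
  refine lt_of_le_of_lt ?_ (ENNReal.add_lt_top.2 ⟨hff, hgf⟩)
  rw [← lintegral_add_left' hmeas]
  apply lintegral_mono_ae
  filter_upwards [h] with x hx
  have h1 := toReal_one_le_aux hx
  have hn := norm_sub_le (f x) (g x)
  have a1 : min c d * ‖f x‖ ≤ c * ‖f x‖ :=
    mul_le_mul_of_nonneg_right (min_le_left _ _) (norm_nonneg _)
  have a2 : min c d * ‖g x‖ ≤ d * ‖g x‖ :=
    mul_le_mul_of_nonneg_right (min_le_right _ _) (norm_nonneg _)
  have a3 := mul_le_mul_of_nonneg_left hn hmin.le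
  rcases le_total (c * ‖f x‖) (d * ‖g x‖) with hl | hl
  · refine le_trans ?_ le_add_self
    apply ENNReal.ofReal_le_ofReal
    apply Real.rpow_le_rpow (by positivity) _ (by linarith)
    linarith
  · refine le_trans ?_ le_self_add
    apply ENNReal.ofReal_le_ofReal
    apply Real.rpow_le_rpow (by positivity) _ (by linarith)
    linarith

lemma sbdd_mono_aux {E : Type*} [NormedAddCommGroup E] (p₁ p₂ : ℝ → ℝ≥0∞) (I : Set ℝ) (f : ℝ → E)
    (h₁ : ∀ᵐ x ∂(volume.restrict (Set.Icc (0:ℝ) 1)), 1 ≤ p₁ x ∧ p₁ x ≠ ∞)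
    (h₂ : ∀ᵐ x ∂(volume.restrict (Set.Icc (0:ℝ) 1)), 1 ≤ p₂ x ∧ p₂ x ≠ ∞)
    (h : ∀ᵐ x ∂(volume.restrict (Set.Icc (0:ℝ) 1)), p₁ x ≤ p₂ x)
    (hf : SBdd p₂ I f) : SBdd p₁ I f := by
  obtain ⟨hm, C, hC⟩ := hf
  refine ⟨fun t ht => mem_mono_aux p₁ p₂ _ h₁ h₂ h (hm t ht), 2 * C, ?_⟩
  rintro _ ⟨t, ht, rfl⟩
  have a := lux_le_aux p₁ p₂ _ h₁ h₂ h (hm t ht)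
  have b := hC ⟨t, ht, rfl⟩
  dsimp only at b ⊢
  linarith

lemma aas_mono_aux {E : Type*} [NormedAddCommGroup E] (p₁ p₂ : ℝ → ℝ≥0∞) (hp₂ : Measurable p₂)
    (f : ℝ → E)
    (h₁ : ∀ᵐ x ∂(volume.restrict (Set.Icc (0:ℝ) 1)), 1 ≤ p₁ x ∧ p₁ x ≠ ∞)
    (h₂ : ∀ᵐ x ∂(volume.restrict (Set.Icc (0:ℝ) 1)), 1 ≤ p₂ x ∧ p₂ x ≠ ∞)
    (h : ∀ᵐ x ∂(volume.restrict (Set.Icc (0:ℝ) 1)), p₁ x ≤ p₂ x)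
    (hf : AASVar p₂ f) : AASVar p₁ f := by
  obtain ⟨hs, hf⟩ := hf
  refine ⟨sbdd_mono_aux p₁ p₂ _ f h₁ h₂ h hs, fun a => ?_⟩
  obtain ⟨n, hn, g, hg, hlim⟩ := hf a
  refine ⟨n, hn, g, sbdd_mono_aux p₁ p₂ _ g h₁ h₂ h hg, fun t => ⟨?_, ?_⟩⟩
  · refine squeeze_zero (fun k => lux_nonneg_aux _ _) (fun k => ?_)
      (by simpa using (hlim t).1.const_mul 2)
    exact lux_le_aux p₁ p₂ _ h₁ h₂ h (mem_sub_aux p₂ hp₂ _ _ h₂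
      (hs.1 (a (n k) + t) (mem_univ _)) (hg.1 t (mem_univ _)))
  · refine squeeze_zero (fun k => lux_nonneg_aux _ _) (fun k => ?_)
      (by simpa using (hlim t).2.const_mul 2)
    exact lux_le_aux p₁ p₂ _ h₁ h₂ h (mem_sub_aux p₂ hp₂ _ _ h₂
      (hg.1 (t - a (n k)) (mem_univ _)) (hs.1 t (mem_univ _)))

lemma aaas_mono_aux {E : Type*} [NormedAddCommGroup E] (p₁ p₂ : ℝ → ℝ≥0∞) (hp₂ : Measurable p₂)
    (h₁ : ∀ᵐ x ∂(volume.restrict (Set.Icc (0:ℝ) 1)), 1 ≤ p₁ x ∧ p₁ x ≠ ∞)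
    (h₂ : ∀ᵐ x ∂(volume.restrict (Set.Icc (0:ℝ) 1)), 1 ≤ p₂ x ∧ p₂ x ≠ ∞)
    (h : ∀ᵐ x ∂(volume.restrict (Set.Icc (0:ℝ) 1)), p₁ x ≤ p₂ x) :
    (∀ f : ℝ → E, AAASVar p₂ f → AAASVar p₁ f) ∧
      ∃ c : ℝ, 0 < c ∧ ∀ f : ℝ → E, AAASVar p₂ f →
        SNorm p₁ (Set.Ici 0) f ≤ c * SNorm p₂ (Set.Ici 0) f := by
  refine ⟨?_, 2, by norm_num, ?_⟩
  · rintro f ⟨hs, g, q, hg, hq, hfe, hlim⟩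
    refine ⟨sbdd_mono_aux p₁ p₂ _ f h₁ h₂ h hs, g, q, aas_mono_aux p₁ p₂ hp₂ g h₁ h₂ h hg,
      sbdd_mono_aux p₁ p₂ _ q h₁ h₂ h hq, hfe, ?_⟩
    refine squeeze_zero' (Eventually.of_forall fun t => lux_nonneg_aux _ _) ?_
      (by simpa using hlim.const_mul 2)
    filter_upwards [eventually_ge_atTop 0] with t ht
    exact lux_le_aux p₁ p₂ _ h₁ h₂ h (hq.1 t ht)
  · rintro f ⟨hs, -⟩
    apply csSup_le (Set.Nonempty.image _ ⟨0, Set.mem_Ici.2 le_rfl⟩)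
    rintro _ ⟨t, ht, rfl⟩
    have a := lux_le_aux p₁ p₂ _ h₁ h₂ h (hs.1 t ht)
    have b := le_csSup hs.2 ⟨t, ht, rfl⟩
    unfold SNorm
    dsimp only at a b ⊢
    linarith

/-- if 1 ≤ p⁻ ≤ p(x) ≤ p⁺ < ∞ a.e., then
AAAS^{p⁺}([0,∞):X) ⊆ AAAS^{p(x)}([0,∞):X) ⊆ AAAS^{p⁻}([0,∞):X) with continuous embeddings. -/
theorem aaas_const_exponent_embeddings
    {X : Type*} [NormedAddCommGroup X] [NormedSpace ℂ X] [CompleteSpace X]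
    (p : ℝ → ℝ≥0∞) (hpmeas : Measurable p)
    (pm pp : ℝ) (hpm : 1 ≤ pm) (hpmpp : pm ≤ pp)
    (hb : ∀ᵐ x ∂(MeasureTheory.volume.restrict (Set.Icc (0:ℝ) 1)),
      ENNReal.ofReal pm ≤ p x ∧ p x ≤ ENNReal.ofReal pp) :
    ((∀ f : ℝ → X, AAASVar (fun _ => ENNReal.ofReal pp) f → AAASVar p f) ∧
      ∃ c : ℝ, 0 < c ∧ ∀ f : ℝ → X, AAASVar (fun _ => ENNReal.ofReal pp) f →
        SNorm p (Set.Ici 0) f ≤ c * SNorm (fun _ => ENNReal.ofReal pp) (Set.Ici 0) f) ∧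
    ((∀ f : ℝ → X, AAASVar p f → AAASVar (fun _ => ENNReal.ofReal pm) f) ∧
      ∃ c : ℝ, 0 < c ∧ ∀ f : ℝ → X, AAASVar p f →
        SNorm (fun _ => ENNReal.ofReal pm) (Set.Ici 0) f ≤ c * SNorm p (Set.Ici 0) f) := by
  have hpp : 1 ≤ pp := hpm.trans hpmpp
  have h : ∀ᵐ x ∂(volume.restrict (Set.Icc (0:ℝ) 1)), 1 ≤ p x ∧ p x ≠ ∞ := by
    filter_upwards [hb] with x hx
    exact ⟨le_trans (by simpa using hpm) hx.1, (hx.2.trans_lt ENNReal.ofReal_lt_top).ne⟩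
  have hc : ∀ r : ℝ, 1 ≤ r → ∀ᵐ x ∂(volume.restrict (Set.Icc (0:ℝ) 1)),
      1 ≤ (fun _ : ℝ => ENNReal.ofReal r) x ∧ (fun _ : ℝ => ENNReal.ofReal r) x ≠ ∞ := by
    intro r hr
    exact Eventually.of_forall fun x => ⟨by simpa using hr, ENNReal.ofReal_ne_top⟩
  exact ⟨aaas_mono_aux p _ measurable_const h (hc pp hpp) (hb.mono fun x hx => hx.2),
    aaas_mono_aux _ p hpmeas (hc pm hpm) h (hb.mono fun x hx => hx.1)⟩

end
end

section
/- Let p, q : [0,1] → [1,∞] be Lebesgue measurable with p(x) ≤ q(x) for a.e. x ∈ [0,1]. Then AAAS^{q(x)}([0,∞):X) ⊆ AAAS^{p(x)}([0,∞):X), and the embedding is continuous with respect to the Stepanov norms ‖·‖_{S^{q(x)}} and ‖·‖_{S^{p(x)}}. -/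
open MeasureTheory Filter Topology Set
open scoped ENNReal

noncomputable section

theorem phiVar_mono (p : ℝ → ℝ≥0∞) (x : ℝ) {s t : ℝ} (hs : 0 ≤ s) (hst : s ≤ t) :
    phiVar p x s ≤ phiVar p x t := by
  unfold phiVar
  split_ifs with h h1 h2 h2
  · exact ENNReal.ofReal_le_ofReal (Real.rpow_le_rpow hs hst ENNReal.toReal_nonneg)
  · exact le_rfl
  · exact zero_le
  · linarith
  · exact le_rfl

theorem phiVar_scale (p : ℝ → ℝ≥0∞) (x : ℝ) (hp : 1 ≤ p x) {t N : ℝ} (ht : 0 ≤ t) (hN : 1 ≤ N) :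
    phiVar p x (t / N) ≤ ENNReal.ofReal N⁻¹ * phiVar p x t := by
  have hN0 : 0 < N := by linarith
  unfold phiVar
  split_ifs with h h1 h2 h2
  · rw [← ENNReal.ofReal_mul (by positivity)]
    apply ENNReal.ofReal_le_ofReal
    have h1 : 1 ≤ (p x).toReal := by
      have := (ENNReal.toReal_le_toReal (by simp) h).2 hp
      simpa using this
    rw [div_eq_inv_mul, Real.mul_rpow (by positivity) ht]
    apply mul_le_mul_of_nonneg_right _ (by positivity)
    have := Real.rpow_le_rpow_of_exponent_ge (inv_pos.2 hN0) (inv_le_one_of_one_le₀ hN) h1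
    simpa using this
  · exact zero_le
  · exact zero_le
  · exact absurd ((div_le_self ht hN).trans h2) h1
  · rw [ENNReal.mul_top]
    simpa using hN0

theorem phiVar_exp (p q : ℝ → ℝ≥0∞) (x : ℝ) (hpq : p x ≤ q x) {t : ℝ} (ht : 0 ≤ t) :
    phiVar p x t ≤ 1 + phiVar q x t := by
  rcases le_or_gt t 1 with h1 | h1
  · refine le_trans ?_ le_self_add
    unfold phiVar
    split_ifs
    · rw [← ENNReal.ofReal_one]
      exact ENNReal.ofReal_le_ofReal (Real.rpow_le_one ht h1 ENNReal.toReal_nonneg)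
    · exact zero_le
  · refine le_trans ?_ le_add_self
    unfold phiVar
    by_cases hq : q x = ∞
    · simp [hq, not_le.2 h1]
    · have hp : p x ≠ ∞ := ne_top_of_le_ne_top hq hpq
      simp only [hq, hp, ne_eq, not_false_eq_true, if_true]
      exact ENNReal.ofReal_le_ofReal (Real.rpow_le_rpow_of_exponent_le h1.le
        ((ENNReal.toReal_le_toReal hp hq).2 hpq))

theorem phiVar_meas (p : ℝ → ℝ≥0∞) (hp : Measurable p) :
    Measurable (fun z : ℝ × ℝ => phiVar p z.1 z.2) := by
  unfold phiVar
  have h1 : Measurable (fun z : ℝ × ℝ => p z.1) := hp.comp measurable_fst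
  refine Measurable.ite ?_ ?_ ?_
  · exact (h1 (measurableSet_singleton ∞)).compl
  · exact (measurable_snd.pow h1.ennreal_toReal).ennreal_ofReal
  · exact Measurable.ite (measurableSet_le measurable_snd measurable_const)
      measurable_const measurable_const

theorem rhoVar_scale (p : ℝ → ℝ≥0∞) (hp : ∀ x ∈ Set.Icc (0:ℝ) 1, 1 ≤ p x) {u : ℝ → ℝ}
    (hu : ∀ x, 0 ≤ u x) {N : ℝ} (hN : 1 ≤ N) :
    rhoVar p (fun x => u x / N) ≤ ENNReal.ofReal N⁻¹ * rhoVar p u := by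
  unfold rhoVar
  rw [← lintegral_const_mul' _ _ ENNReal.ofReal_ne_top]
  apply setLIntegral_mono' measurableSet_Icc
  intro x hx
  exact phiVar_scale p x (hp x hx) (hu x) hN

theorem rhoVar_exp (p q : ℝ → ℝ≥0∞)
    (hpq : ∀ᵐ x ∂(volume.restrict (Set.Icc (0:ℝ) 1)), p x ≤ q x) {u : ℝ → ℝ}
    (hu : ∀ x, 0 ≤ u x) : rhoVar p u ≤ 1 + rhoVar q u := by
  unfold rhoVar
  calc _ ≤ ∫⁻ x in Set.Icc (0:ℝ) 1, (1 + phiVar q x (u x)) :=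
        lintegral_mono_ae (hpq.mono fun x hx => phiVar_exp p q x hx (hu x))
    _ = _ := by
        rw [lintegral_add_left measurable_const]
        simp

theorem rhoVar_mono (p : ℝ → ℝ≥0∞) {u v : ℝ → ℝ}
    (hu : ∀ x, 0 ≤ u x) (huv : ∀ x, u x ≤ v x) : rhoVar p u ≤ rhoVar p v :=
  lintegral_mono fun x => phiVar_mono p x (hu x) (huv x)

section
variable {E : Type*} [NormedAddCommGroup E]

theorem luxNorm_nonneg (p : ℝ → ℝ≥0∞) (f : ℝ → E) : 0 ≤ luxNorm p f :=
  Real.sInf_nonneg fun _ h => h.1.le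

theorem MemLpVar_nonempty {p : ℝ → ℝ≥0∞} (hp : ∀ x ∈ Set.Icc (0:ℝ) 1, 1 ≤ p x) {f : ℝ → E}
    (hf : MemLpVar p f) : {lam : ℝ | 0 < lam ∧ rhoVar p (fun x => ‖f x‖ / lam) ≤ 1}.Nonempty := by
  obtain ⟨-, c, hc, hr⟩ := hf
  set R := rhoVar p (fun x => c * ‖f x‖) with hR
  set N : ℝ := max 1 R.toReal with hN
  have hN1 : 1 ≤ N := le_max_left _ _
  have hN0 : 0 < N := by linarith
  refine ⟨N / c, by positivity, ?_⟩
  have h := rhoVar_scale p hp (u := fun x => c * ‖f x‖) (fun x => by positivity) hN1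
  have e : (fun x => ‖f x‖ / (N / c)) = fun x => c * ‖f x‖ / N := by
    funext x; field_simp
  rw [e]
  refine h.trans ?_
  rw [← hR, ← ENNReal.ofReal_toReal hr.ne, ← ENNReal.ofReal_mul (by positivity),
    ← ENNReal.ofReal_one]
  apply ENNReal.ofReal_le_ofReal
  rw [inv_mul_le_iff₀ hN0, mul_one]
  exact le_max_right _ _

theorem MemLpVar_exp {p q : ℝ → ℝ≥0∞}
    (hpq : ∀ᵐ x ∂(volume.restrict (Set.Icc (0:ℝ) 1)), p x ≤ q x) {f : ℝ → E}
    (hf : MemLpVar q f) : MemLpVar p f := by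
  obtain ⟨hm, c, hc, hr⟩ := hf
  refine ⟨hm, c, hc, (rhoVar_exp p q hpq fun x => by positivity).trans_lt ?_⟩
  exact ENNReal.add_lt_top.2 ⟨ENNReal.one_lt_top, hr⟩

theorem luxNorm_exp {p q : ℝ → ℝ≥0∞} (hp : ∀ x ∈ Set.Icc (0:ℝ) 1, 1 ≤ p x)
    (hq : ∀ x ∈ Set.Icc (0:ℝ) 1, 1 ≤ q x)
    (hpq : ∀ᵐ x ∂(volume.restrict (Set.Icc (0:ℝ) 1)), p x ≤ q x) {f : ℝ → E}
    (hf : MemLpVar q f) : luxNorm p f ≤ 2 * luxNorm q f := by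
  have key : luxNorm p f / 2 ≤ luxNorm q f := by
    refine le_csInf (MemLpVar_nonempty hq hf) ?_
    rintro lam ⟨hl, hr⟩
    have : luxNorm p f ≤ lam * 2 := by
      refine csInf_le ⟨0, fun _ h => h.1.le⟩ ⟨by positivity, ?_⟩
      have e : (fun x => ‖f x‖ / (lam * 2)) = fun x => ‖f x‖ / lam / 2 := by
        funext x; rw [div_div]
      rw [e]
      refine (rhoVar_scale p hp (u := fun x => ‖f x‖ / lam)
        (fun x => by positivity) one_le_two).trans ?_
      have h2 : rhoVar p (fun x => ‖f x‖ / lam) ≤ 2 := by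
        refine (rhoVar_exp p q hpq fun x => by positivity).trans ?_
        rw [← one_add_one_eq_two]
        gcongr
      calc _ ≤ ENNReal.ofReal 2⁻¹ * 2 := by gcongr
        _ = 1 := by
          rw [ENNReal.ofReal_inv_of_pos two_pos]
          simp [ENNReal.inv_mul_cancel]
    linarith
  linarith

theorem MemLpVar_sub {p : ℝ → ℝ≥0∞} (hp : Measurable p) {f g : ℝ → E}
    (hf : MemLpVar p f) (hg : MemLpVar p g) : MemLpVar p (fun x => f x - g x) := by
  obtain ⟨hfm, c, hc, hfr⟩ := hf
  obtain ⟨hgm, d, hd, hgr⟩ := hg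
  refine ⟨hfm.sub hgm, min c d / 2, by positivity, ?_⟩
  have hb : rhoVar p (fun x => min c d / 2 * ‖f x - g x‖) ≤
      rhoVar p (fun x => c * ‖f x‖) + rhoVar p (fun x => d * ‖g x‖) := by
    unfold rhoVar
    rw [← lintegral_add_left']
    · apply lintegral_mono
      intro x
      have h0 : 0 ≤ min c d / 2 * ‖f x - g x‖ := by positivity
      have hm : min c d / 2 * ‖f x - g x‖ ≤ (c * ‖f x‖ + d * ‖g x‖) / 2 := by
        have h1 : min c d * ‖f x‖ ≤ c * ‖f x‖ := by gcongr; exact min_le_left _ _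
        have h2 : min c d * ‖g x‖ ≤ d * ‖g x‖ := by gcongr; exact min_le_right _ _
        have h3 : min c d * ‖f x - g x‖ ≤ min c d * (‖f x‖ + ‖g x‖) := by
          gcongr; exact norm_sub_le _ _
        linarith
      rcases le_total (c * ‖f x‖) (d * ‖g x‖) with h | h
      · exact (phiVar_mono p x h0 (by linarith)).trans le_add_self
      · exact (phiVar_mono p x h0 (by linarith)).trans le_self_add
    · exact (phiVar_meas p hp).comp_aemeasurable
        (aemeasurable_id.prodMk (hfm.norm.aemeasurable.const_mul c))
  exact hb.trans_lt (ENNReal.add_lt_top.2 ⟨hfr, hgr⟩)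

theorem SBdd_exp {p q : ℝ → ℝ≥0∞} (hp : ∀ x ∈ Set.Icc (0:ℝ) 1, 1 ≤ p x)
    (hq : ∀ x ∈ Set.Icc (0:ℝ) 1, 1 ≤ q x)
    (hpq : ∀ᵐ x ∂(volume.restrict (Set.Icc (0:ℝ) 1)), p x ≤ q x) {I : Set ℝ} {f : ℝ → E}
    (hf : SBdd q I f) : SBdd p I f := by
  refine ⟨fun t ht => MemLpVar_exp hpq (hf.1 t ht), ?_⟩
  obtain ⟨B, hB⟩ := hf.2
  refine ⟨2 * B, ?_⟩
  rintro _ ⟨t, ht, rfl⟩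
  have h1 := luxNorm_exp hp hq hpq (hf.1 t ht)
  have h2 := hB ⟨t, ht, rfl⟩
  simp only at h2 ⊢
  linarith

theorem AASVar_exp {p q : ℝ → ℝ≥0∞} (hqm : Measurable q)
    (hp : ∀ x ∈ Set.Icc (0:ℝ) 1, 1 ≤ p x)
    (hq : ∀ x ∈ Set.Icc (0:ℝ) 1, 1 ≤ q x)
    (hpq : ∀ᵐ x ∂(volume.restrict (Set.Icc (0:ℝ) 1)), p x ≤ q x) {f : ℝ → E}
    (hf : AASVar q f) : AASVar p f := by
  refine ⟨SBdd_exp hp hq hpq hf.1, fun a => ?_⟩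
  obtain ⟨n, hn, g, hg, h⟩ := hf.2 a
  refine ⟨n, hn, g, SBdd_exp hp hq hpq hg, fun t => ⟨?_, ?_⟩⟩
  · refine squeeze_zero (fun k => luxNorm_nonneg _ _) (fun k => luxNorm_exp hp hq hpq ?_)
      (by simpa using (h t).1.const_mul 2)
    exact MemLpVar_sub hqm (hf.1.1 _ trivial) (hg.1 _ trivial)
  · refine squeeze_zero (fun k => luxNorm_nonneg _ _) (fun k => luxNorm_exp hp hq hpq ?_)
      (by simpa using (h t).2.const_mul 2)
    exact MemLpVar_sub hqm (hg.1 _ trivial) (hf.1.1 _ trivial)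

end

/-- if p ≤ q a.e., then AAAS^{q(x)}([0,∞):X) ⊆ AAAS^{p(x)}([0,∞):X)
with a continuous embedding. -/
theorem aaas_monotone_exponent_embedding
    {X : Type*} [NormedAddCommGroup X] [NormedSpace ℂ X] [CompleteSpace X]
    (p q : ℝ → ℝ≥0∞) (hpmeas : Measurable p) (hqmeas : Measurable q)
    (hp1 : ∀ x ∈ Set.Icc (0:ℝ) 1, 1 ≤ p x) (hq1 : ∀ x ∈ Set.Icc (0:ℝ) 1, 1 ≤ q x)
    (hpq : ∀ᵐ x ∂(MeasureTheory.volume.restrict (Set.Icc (0:ℝ) 1)), p x ≤ q x) :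
    (∀ f : ℝ → X, AAASVar q f → AAASVar p f) ∧
    ∃ c : ℝ, 0 < c ∧ ∀ f : ℝ → X, AAASVar q f →
      SNorm p (Set.Ici 0) f ≤ c * SNorm q (Set.Ici 0) f := by
  refine ⟨?_, 2, two_pos, ?_⟩
  · rintro f ⟨hf, g, r, hg, hr, hfg, hr0⟩
    refine ⟨SBdd_exp hp1 hq1 hpq hf, g, r, AASVar_exp hqmeas hp1 hq1 hpq hg,
      SBdd_exp hp1 hq1 hpq hr, hfg, ?_⟩
    have h2 : Tendsto (fun t => 2 * luxNorm q (fun x => r (t + x))) atTop (𝓝 0) := by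
      simpa using hr0.const_mul 2
    refine squeeze_zero' (Eventually.of_forall fun t => luxNorm_nonneg _ _) ?_ h2
    filter_upwards [eventually_ge_atTop (0:ℝ)] with t ht
    exact luxNorm_exp hp1 hq1 hpq (hr.1 t ht)
  · rintro f ⟨hf, -⟩
    refine csSup_le (Set.Nonempty.image _ ⟨0, Set.mem_Ici.2 le_rfl⟩) ?_
    rintro _ ⟨t, ht, rfl⟩
    have h1 := luxNorm_exp hp1 hq1 hpq (hf.1 t ht)
    have h2 := le_csSup hf.2 ⟨t, ht, rfl⟩
    simp only [SNorm] at h1 h2 ⊢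
    linarith


end
end

section
/- Let p : [0,1] → [1,∞] be Lebesgue measurable, let f : ℝ → X be almost automorphic, and assume that ∫_0^1 φ_{p(x)}(λ) dx < ∞ for every λ > 0 (equivalently, ∫_0^1 λ^{p(x)} dx < ∞ for all λ > 0). Then f is Stepanov p(x)-almost automorphic, and ‖f‖_{S^{p(x)}} ≤ sup_{t∈ℝ} ‖f(t)‖. -/
open MeasureTheory Filter Topology Set
open scoped ENNReal

noncomputable section

theorem phiVar_mono_aux (p : ℝ → ℝ≥0∞) (x : ℝ) {s t : ℝ} (hs : 0 ≤ s) (h : s ≤ t) :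
    phiVar p x s ≤ phiVar p x t := by
  unfold phiVar
  split_ifs with h1 h2 h3 h4
  · exact ENNReal.ofReal_le_ofReal (Real.rpow_le_rpow hs h ENNReal.toReal_nonneg)
  · exact le_rfl
  · exact zero_le
  · exact absurd (h.trans h4) h2
  · exact le_rfl

theorem phiVar_le_one_aux (p : ℝ → ℝ≥0∞) (x : ℝ) {s : ℝ} (hs : 0 ≤ s) (h : s ≤ 1) :
    phiVar p x s ≤ 1 := by
  unfold phiVar
  split_ifs with h1
  · exact ENNReal.ofReal_le_one.2 (Real.rpow_le_one hs h ENNReal.toReal_nonneg)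
  · exact zero_le

theorem phiVar_meas_aux (p : ℝ → ℝ≥0∞) (hp : Measurable p) {u : ℝ → ℝ} (hu : Measurable u) :
    Measurable (fun x => phiVar p x (u x)) := by
  unfold phiVar
  refine Measurable.ite ?_ ?_ ?_
  · exact (hp (measurableSet_singleton ∞)).compl
  · exact (hu.pow hp.ennreal_toReal).ennreal_ofReal
  · exact Measurable.ite (measurableSet_le hu measurable_const) measurable_const measurable_const

theorem phiVar_tendsto_aux (p : ℝ → ℝ≥0∞) (x : ℝ) (hx : 1 ≤ p x) {u : ℕ → ℝ}
    (hu : Tendsto u atTop (𝓝 0)) :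
    Tendsto (fun k => phiVar p x (u k)) atTop (𝓝 0) := by
  by_cases h : p x = ∞
  · have : ∀ᶠ k in atTop, u k ≤ 1 := (hu.eventually_lt_const one_pos).mono fun _ h => h.le
    refine tendsto_const_nhds.congr' ?_
    filter_upwards [this] with k hk
    simp [phiVar, h, hk]
  · have h1 : 0 < (p x).toReal := ENNReal.toReal_pos (one_pos.trans_le hx).ne' h
    have h2 := hu.rpow_const (p := (p x).toReal) (Or.inr h1.le)
    rw [Real.zero_rpow h1.ne'] at h2
    have h3 := ENNReal.tendsto_ofReal h2
    simpa [phiVar, h] using h3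

theorem luxNorm_nonneg_aux {E : Type*} [NormedAddCommGroup E] (p : ℝ → ℝ≥0∞) (u : ℝ → E) :
    0 ≤ luxNorm p u := Real.sInf_nonneg fun _ h => h.1.le

theorem luxNorm_le_aux {E : Type*} [NormedAddCommGroup E] (p : ℝ → ℝ≥0∞) (u : ℝ → E) {c : ℝ}
    (hc : 0 < c) (h : rhoVar p (fun x => ‖u x‖ / c) ≤ 1) : luxNorm p u ≤ c :=
  csInf_le ⟨0, fun _ h => h.1.le⟩ ⟨hc, h⟩

theorem luxNorm_le_sup_aux {E : Type*} [NormedAddCommGroup E] (p : ℝ → ℝ≥0∞) (u : ℝ → E) {C : ℝ}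
    (hC : 0 ≤ C) (h : ∀ x, ‖u x‖ ≤ C) : luxNorm p u ≤ C := by
  refine le_of_forall_pos_le_add fun ε hε => luxNorm_le_aux p u (by linarith) ?_
  unfold rhoVar
  calc ∫⁻ x in Set.Icc (0:ℝ) 1, phiVar p x (‖u x‖ / (C + ε))
      ≤ ∫⁻ x in Set.Icc (0:ℝ) 1, 1 := by
        refine lintegral_mono fun x => phiVar_le_one_aux p x (by positivity) ?_
        exact div_le_one_of_le₀ ((h x).trans (by linarith)) (by linarith)
    _ = 1 := by simp

theorem SBdd_aux {E : Type*} [NormedAddCommGroup E] (p : ℝ → ℝ≥0∞)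
    (hint : ∀ lam : ℝ, 0 < lam → (∫⁻ x in Set.Icc (0:ℝ) 1, phiVar p x lam) < ∞)
    (u : ℝ → E) (hu : StronglyMeasurable u) {C : ℝ} (hC : 0 ≤ C) (h : ∀ x, ‖u x‖ ≤ C) :
    SBdd p Set.univ u := by
  refine ⟨fun t _ => ⟨(hu.comp_measurable (measurable_const_add t)).aestronglyMeasurable,
    1, one_pos, ?_⟩, C, ?_⟩
  · refine lt_of_le_of_lt (lintegral_mono fun x => ?_) (hint (C + 1) (by linarith))
    exact phiVar_mono_aux p x (by positivity) (by linarith [h (t + x)])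
  · rintro _ ⟨t, _, rfl⟩
    exact luxNorm_le_sup_aux p _ hC fun x => h _

theorem luxNorm_tendsto_aux {E : Type*} [NormedAddCommGroup E] (p : ℝ → ℝ≥0∞) (hp : Measurable p)
    (hp1 : ∀ x ∈ Set.Icc (0:ℝ) 1, 1 ≤ p x)
    (hint : ∀ lam : ℝ, 0 < lam → (∫⁻ x in Set.Icc (0:ℝ) 1, phiVar p x lam) < ∞)
    (u : ℕ → ℝ → E) (hu : ∀ k, StronglyMeasurable (u k)) {C : ℝ} (hC : 0 < C)
    (h : ∀ k x, ‖u k x‖ ≤ C) (hlim : ∀ x, Tendsto (fun k => u k x) atTop (𝓝 0)) :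
    Tendsto (fun k => luxNorm p (u k)) atTop (𝓝 0) := by
  have key : ∀ ε : ℝ, 0 < ε →
      Tendsto (fun k => rhoVar p (fun x => ‖u k x‖ / ε)) atTop (𝓝 0) := by
    intro ε hε
    have := tendsto_lintegral_of_dominated_convergence
      (μ := volume.restrict (Set.Icc (0:ℝ) 1))
      (F := fun k x => phiVar p x (‖u k x‖ / ε)) (f := fun _ => 0)
      (fun x => phiVar p x (C / ε))
      (fun k => phiVar_meas_aux p hp ((hu k).norm.measurable.div_const ε))
      (fun k => Eventually.of_forall fun x => phiVar_mono_aux p x (by positivity)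
        (div_le_div_of_nonneg_right (h k x) hε.le))
      (hint _ (by positivity)).ne
      (by
        filter_upwards [ae_restrict_mem measurableSet_Icc] with x hx
        refine phiVar_tendsto_aux p x (hp1 x hx) ?_
        simpa using (hlim x).norm.div_const ε)
    simpa [rhoVar] using this
  rw [Metric.tendsto_atTop']
  intro ε hε
  have h1 := ((key (ε / 2) (by positivity)).eventually_lt_const one_pos)
  obtain ⟨N, hN⟩ := eventually_atTop.1 h1
  refine ⟨N, fun k hk => ?_⟩
  have h2 := luxNorm_le_aux p (u k) (by positivity) (hN k hk.le).le
  rw [Real.dist_eq, sub_zero, abs_of_nonneg (luxNorm_nonneg_aux p _)]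
  linarith

theorem aa_bdd_aux {E : Type*} [NormedAddCommGroup E] (f : ℝ → E) (hf : AlmostAutomorphic f) :
    BddAbove (Set.range fun t => ‖f t‖) := by
  by_contra hb
  have : ∀ n : ℕ, ∃ t, (n : ℝ) < ‖f t‖ := by
    intro n
    by_contra! hn
    exact hb ⟨n, by rintro _ ⟨t, rfl⟩; exact hn t⟩
  choose b hb using this
  obtain ⟨n, hn, g, hg, -⟩ := hf.2 b
  have h1 := (hg 0).norm
  refine not_tendsto_nhds_of_tendsto_atTop ?_ _ h1
  refine tendsto_atTop_mono (fun k => ?_)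
    (tendsto_natCast_atTop_atTop.comp hn.tendsto_atTop)
  simpa using (hb (n k)).le

/-- if ∫_0^1 φ_{p(x)}(λ) dx < ∞ for all λ > 0, then every almost automorphic
function is Stepanov p(x)-almost automorphic, with ‖f‖_{S^{p(x)}} ≤ sup_t ‖f(t)‖. -/
theorem almost_automorphic_implies_stepanov_px_aa
    {X : Type*} [NormedAddCommGroup X] [NormedSpace ℂ X] [CompleteSpace X]
    (p : ℝ → ℝ≥0∞) (hpmeas : Measurable p) (hp1 : ∀ x ∈ Set.Icc (0:ℝ) 1, 1 ≤ p x)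
    (hint : ∀ lam : ℝ, 0 < lam → (∫⁻ x in Set.Icc (0:ℝ) 1, phiVar p x lam) < ∞)
    (f : ℝ → X) (hf : AlmostAutomorphic f) :
    AASVar p f ∧ SNorm p Set.univ f ≤ ⨆ t : ℝ, ‖f t‖ := by
  have hb := aa_bdd_aux f hf
  have hM : ∀ t, ‖f t‖ ≤ ⨆ t : ℝ, ‖f t‖ := fun t => le_ciSup hb t
  set M := ⨆ t : ℝ, ‖f t‖ with hMdef
  have hM0 : 0 ≤ M := (norm_nonneg _).trans (hM 0)
  have hfm : StronglyMeasurable f := hf.1.stronglyMeasurable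
  refine ⟨⟨SBdd_aux p hint f hfm hM0 hM, fun a => ?_⟩, ?_⟩
  · obtain ⟨n, hn, g, hg, hg'⟩ := hf.2 a
    have hgm : StronglyMeasurable g := by
      refine stronglyMeasurable_of_tendsto atTop
        (f := fun k t => f (t + a (n k))) (fun k => ?_) (tendsto_pi_nhds.2 hg)
      exact hfm.comp_measurable (measurable_add_const _)
    have hgM : ∀ t, ‖g t‖ ≤ M := fun t =>
      le_of_tendsto (hg t).norm (Eventually.of_forall fun k => hM _)
    refine ⟨n, hn, g, SBdd_aux p hint g hgm hM0 hgM, fun t => ⟨?_, ?_⟩⟩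
    · refine luxNorm_tendsto_aux p hpmeas hp1 hint _ (fun k => ?_) (C := 2 * M + 1)
        (by linarith) (fun k x => ?_) (fun x => ?_)
      · exact (hfm.comp_measurable (measurable_const_add _)).sub
          (hgm.comp_measurable (measurable_const_add _))
      · exact (norm_sub_le _ _).trans (by linarith [hM (a (n k) + t + x), hgM (t + x)])
      · have h1 := (hg (t + x)).sub_const (g (t + x))
        rw [sub_self] at h1
        refine h1.congr fun k => ?_
        congr 2
        ring
    · refine luxNorm_tendsto_aux p hpmeas hp1 hint _ (fun k => ?_) (C := 2 * M + 1)
        (by linarith) (fun k x => ?_) (fun x => ?_)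
      · exact (hgm.comp_measurable (measurable_const_add _)).sub
          (hfm.comp_measurable (measurable_const_add _))
      · exact (norm_sub_le _ _).trans (by linarith [hgM (t - a (n k) + x), hM (t + x)])
      · have h1 := (hg' (t + x)).sub_const (f (t + x))
        rw [sub_self] at h1
        refine h1.congr fun k => ?_
        congr 2
        ring
  · refine csSup_le (Set.univ_nonempty.image _) ?_
    rintro _ ⟨t, _, rfl⟩
    exact luxNorm_le_sup_aux p _ hM0 fun x => hM _

end
end

section
/- A bounded continuous function f : ℝ → X is compactly almost automorphic if and only if f ∈ AAS^{∞}(ℝ:X); that is, AA_c(ℝ:X) = AAS^{∞}(ℝ:X) ∩ C_b(ℝ:X), where AAS^{∞} denotes the Stepanov p(x)-almost automorphic class for the constant exponent p(x) ≡ ∞, in which case the Luxemburg norm on L^{p(x)}([0,1]:X) is the essential supremum norm on [0,1]. -/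
open MeasureTheory Filter Topology Set
open scoped ENNReal

noncomputable section

theorem aux_phi (x t : ℝ) : phiVar (fun _ => (∞ : ℝ≥0∞)) x t = if t ≤ 1 then 0 else ∞ := by
  simp [phiVar]

theorem aux_rho_zero {u : ℝ → ℝ}
    (h : ∀ᵐ x ∂(volume.restrict (Set.Icc (0:ℝ) 1)), u x ≤ 1) :
    rhoVar (fun _ => (∞ : ℝ≥0∞)) u = 0 := by
  unfold rhoVar
  rw [lintegral_congr_ae (g := fun _ => 0)]
  · simp
  · filter_upwards [h] with x hx
    rw [aux_phi, if_pos hx]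

theorem aux_ae_of_rho {u : ℝ → ℝ}
    (hu : AEMeasurable u (volume.restrict (Set.Icc (0:ℝ) 1)))
    (h : rhoVar (fun _ => (∞ : ℝ≥0∞)) u < ∞) :
    ∀ᵐ x ∂(volume.restrict (Set.Icc (0:ℝ) 1)), u x ≤ 1 := by
  have hm : Measurable (fun t : ℝ => if t ≤ 1 then (0 : ℝ≥0∞) else ∞) :=
    Measurable.ite measurableSet_Iic measurable_const measurable_const
  unfold rhoVar at h
  simp_rw [aux_phi] at h
  have := ae_lt_top' (hm.comp_aemeasurable hu) h.ne
  filter_upwards [this] with x hx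
  by_contra hc
  simp [hc] at hx

section aux
variable {E : Type*} [NormedAddCommGroup E]

theorem aux_memLp_iff (u : ℝ → E) : MemLpVar (fun _ => (∞ : ℝ≥0∞)) u ↔
    AEStronglyMeasurable u (volume.restrict (Set.Icc (0:ℝ) 1)) ∧
      ∃ M : ℝ, ∀ᵐ x ∂(volume.restrict (Set.Icc (0:ℝ) 1)), ‖u x‖ ≤ M := by
  constructor
  · rintro ⟨hm, c, hc, h⟩
    refine ⟨hm, 1 / c, ?_⟩
    filter_upwards [aux_ae_of_rho (hm.norm.aemeasurable.const_mul c) h] with x hx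
    rw [le_div_iff₀ hc]; linarith
  · rintro ⟨hm, M, h⟩
    refine ⟨hm, 1 / (|M| + 1), by positivity, ?_⟩
    rw [aux_rho_zero]
    · simp
    · filter_upwards [h] with x hx
      rw [div_mul_eq_mul_div, div_le_one (by positivity)]
      linarith [le_abs_self M]

theorem aux_lux_nonneg (u : ℝ → E) : 0 ≤ luxNorm (fun _ => (∞ : ℝ≥0∞)) u :=
  Real.sInf_nonneg fun _ h => h.1.le

theorem aux_lux_le {u : ℝ → E} {ε : ℝ} (hε : 0 < ε)
    (h : ∀ᵐ x ∂(volume.restrict (Set.Icc (0:ℝ) 1)), ‖u x‖ ≤ ε) :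
    luxNorm (fun _ => (∞ : ℝ≥0∞)) u ≤ ε := by
  refine csInf_le ⟨0, fun _ h => h.1.le⟩ ⟨hε, ?_⟩
  rw [aux_rho_zero]
  · simp
  · filter_upwards [h] with x hx
    rwa [div_le_one hε]

theorem aux_ae_of_lux {u : ℝ → E} {ε : ℝ} (hu : MemLpVar (fun _ => (∞ : ℝ≥0∞)) u)
    (h : luxNorm (fun _ => (∞ : ℝ≥0∞)) u < ε) :
    ∀ᵐ x ∂(volume.restrict (Set.Icc (0:ℝ) 1)), ‖u x‖ ≤ ε := by
  obtain ⟨hm, M, hM⟩ := (aux_memLp_iff u).1 hu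
  have hne : {lam : ℝ | 0 < lam ∧
      rhoVar (fun _ => (∞ : ℝ≥0∞)) (fun x => ‖u x‖ / lam) ≤ 1}.Nonempty := by
    refine ⟨|M| + 1, by positivity, ?_⟩
    rw [aux_rho_zero]
    · simp
    · filter_upwards [hM] with x hx
      rw [div_le_one (by positivity)]
      linarith [le_abs_self M]
  obtain ⟨lam, ⟨hl, hr⟩, hlt⟩ := exists_lt_of_csInf_lt hne h
  filter_upwards [aux_ae_of_rho (hm.norm.aemeasurable.div_const lam)
    (hr.trans_lt ENNReal.one_lt_top)] with x hx
  rw [div_le_one hl] at hx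
  linarith

theorem aux_memLp_sub {u v : ℝ → E} (hu : MemLpVar (fun _ => (∞ : ℝ≥0∞)) u)
    (hv : MemLpVar (fun _ => (∞ : ℝ≥0∞)) v) :
    MemLpVar (fun _ => (∞ : ℝ≥0∞)) (fun x => u x - v x) := by
  rw [aux_memLp_iff] at *
  obtain ⟨hm, M, hM⟩ := hu
  obtain ⟨hm', M', hM'⟩ := hv
  refine ⟨hm.sub hm', M + M', ?_⟩
  filter_upwards [hM, hM'] with x h1 h2
  exact (norm_sub_le _ _).trans (add_le_add h1 h2)

theorem aux_sbdd {f : ℝ → E} (hf : Continuous f) {C : ℝ} (hC : ∀ t, ‖f t‖ ≤ C) :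
    SBdd (fun _ => (∞ : ℝ≥0∞)) Set.univ f := by
  refine ⟨fun t _ => (aux_memLp_iff _).2 ⟨?_, C, Eventually.of_forall fun x => hC _⟩,
    |C| + 1, ?_⟩
  · exact (hf.comp (continuous_const.add continuous_id)).aestronglyMeasurable
  · rintro _ ⟨t, -, rfl⟩
    refine aux_lux_le (by positivity) (Eventually.of_forall fun x => ?_)
    linarith [le_abs_self C, hC (t + x)]

theorem aux_everywhere {h : ℝ → E} (hc : Continuous h) {ε : ℝ}
    (hh : ∀ᵐ x ∂(volume.restrict (Set.Icc (0:ℝ) 1)), ‖h x‖ ≤ ε) :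
    ∀ x ∈ Set.Icc (0:ℝ) 1, ‖h x‖ ≤ ε := by
  have := Measure.eqOn_Icc_of_ae_eq (μ := volume) (a := (0:ℝ)) (b := 1) (by norm_num)
    (f := fun x => max ‖h x‖ ε) (g := fun _ => ε)
    (by filter_upwards [hh] with x hx; exact max_eq_right hx)
    (hc.norm.max continuous_const).continuousOn continuousOn_const
  intro x hx
  exact (le_max_left _ _).trans (this hx).le

theorem aux_lux_tendsto {u : ℕ → ℝ → E}
    (h : ∀ ε > 0, ∀ᶠ k in atTop, ∀ x ∈ Set.Icc (0:ℝ) 1, ‖u k x‖ < ε) :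
    Tendsto (fun k => luxNorm (fun _ => (∞ : ℝ≥0∞)) (u k)) atTop (𝓝 0) := by
  rw [Metric.tendsto_nhds]
  intro ε hε
  filter_upwards [h (ε / 2) (by positivity)] with k hk
  rw [Real.dist_eq, sub_zero, abs_of_nonneg (aux_lux_nonneg _)]
  have : luxNorm (fun _ => (∞ : ℝ≥0∞)) (u k) ≤ ε / 2 := by
    refine aux_lux_le (by positivity) ?_
    filter_upwards [ae_restrict_mem measurableSet_Icc] with x hx using (hk x hx).le
  linarith

theorem aux_locunif {F : ℕ → ℝ → E} {G : ℝ → E}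
    (h : ∀ t : ℝ, ∀ ε > 0, ∀ᶠ k in atTop, ∀ x ∈ Set.Icc (0:ℝ) 1,
      ‖F k (t + x) - G (t + x)‖ ≤ ε) : TendstoLocallyUniformly F G atTop := by
  rw [Metric.tendstoLocallyUniformly_iff]
  intro ε hε s
  refine ⟨Set.Icc (s - 1/2) (s + 1/2), Icc_mem_nhds (by linarith) (by linarith), ?_⟩
  filter_upwards [h (s - 1/2) (ε/2) (by positivity)] with k hk y hy
  have := hk (y - (s - 1/2)) ⟨by linarith [hy.1], by linarith [hy.2]⟩
  rw [add_sub_cancel] at this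
  rw [dist_comm, dist_eq_norm]
  linarith

end aux

/-- a bounded continuous f : ℝ → X is compactly almost automorphic iff it is
Stepanov ∞-almost automorphic; i.e. AA_c(ℝ:X) = AAS^{∞}(ℝ:X) ∩ C_b(ℝ:X). -/
theorem compact_aa_iff_stepanov_infty_aa
    {X : Type*} [NormedAddCommGroup X] [NormedSpace ℂ X] [CompleteSpace X]
    (f : ℝ → X) (hfc : Continuous f) (hfb : ∃ C : ℝ, ∀ t : ℝ, ‖f t‖ ≤ C) :
    CompactAA f ↔ AASVar (fun _ => (∞ : ℝ≥0∞)) f := by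
  obtain ⟨C, hC⟩ := hfb
  constructor
  · rintro ⟨-, H⟩
    refine ⟨aux_sbdd hfc hC, fun a => ?_⟩
    obtain ⟨n, hn, g, h1, h2⟩ := H a
    have hloc := tendstoLocallyUniformly_iff_forall_isCompact.2 h1
    have hgc : Continuous g := hloc.continuous (Frequently.of_forall fun k => by fun_prop)
    have hgC : ∀ t, ‖g t‖ ≤ C := fun t =>
      le_of_tendsto ((h1 {t} isCompact_singleton).tendsto_at rfl).norm
        (Eventually.of_forall fun k => hC _)
    refine ⟨n, hn, g, aux_sbdd hgc hgC, fun t => ⟨?_, ?_⟩⟩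
    · refine aux_lux_tendsto fun ε hε => ?_
      filter_upwards [Metric.tendstoUniformlyOn_iff.1 (h1 (Set.Icc t (t+1)) isCompact_Icc) ε hε]
        with k hk x hx
      have := hk (t + x) ⟨by linarith [hx.1], by linarith [hx.2]⟩
      rw [dist_comm, dist_eq_norm] at this
      rwa [show a (n k) + t + x = t + x + a (n k) by ring]
    · refine aux_lux_tendsto fun ε hε => ?_
      filter_upwards [Metric.tendstoUniformlyOn_iff.1 (h2 (Set.Icc t (t+1)) isCompact_Icc) ε hε]
        with k hk x hx
      have := hk (t + x) ⟨by linarith [hx.1], by linarith [hx.2]⟩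
      rw [dist_comm, dist_eq_norm] at this
      rwa [show t - a (n k) + x = t + x - a (n k) by ring]
  · rintro ⟨hfS, H⟩
    refine ⟨hfc, fun b => ?_⟩
    obtain ⟨n, hn, g, hgS, hg⟩ := H b
    have H1 : ∀ t : ℝ, ∀ ε > 0, ∃ N, ∀ k ≥ N,
        ∀ᵐ x ∂(volume.restrict (Set.Icc (0:ℝ) 1)),
          ‖f (t + x + b (n k)) - g (t + x)‖ ≤ ε := by
      intro t ε hε
      obtain ⟨N, hN⟩ := eventually_atTop.1 ((hg t).1.eventually_lt_const hε)
      refine ⟨N, fun k hk => ?_⟩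
      have := aux_ae_of_lux (aux_memLp_sub (hfS.1 (b (n k) + t) (mem_univ _))
        (hgS.1 t (mem_univ _))) (hN k hk)
      filter_upwards [this] with x hx
      rwa [show t + x + b (n k) = b (n k) + t + x by ring]
    have H2 : ∀ t : ℝ, ∀ ε > 0, ∃ N, ∀ k ≥ N,
        ∀ᵐ x ∂(volume.restrict (Set.Icc (0:ℝ) 1)),
          ‖g (t - b (n k) + x) - f (t + x)‖ ≤ ε := by
      intro t ε hε
      obtain ⟨N, hN⟩ := eventually_atTop.1 ((hg t).2.eventually_lt_const hε)
      exact ⟨N, fun k hk => aux_ae_of_lux (aux_memLp_sub (hgS.1 (t - b (n k)) (mem_univ _))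
        (hfS.1 t (mem_univ _))) (hN k hk)⟩
    have H3 : ∀ t : ℝ, ∀ ε > 0, ∃ N, ∀ k ≥ N, ∀ j ≥ N, ∀ x ∈ Set.Icc (0:ℝ) 1,
        ‖f (t + x + b (n k)) - f (t + x + b (n j))‖ ≤ ε := by
      intro t ε hε
      obtain ⟨N, hN⟩ := H1 t (ε / 2) (by positivity)
      refine ⟨N, fun k hk j hj => aux_everywhere (by fun_prop) ?_⟩
      filter_upwards [hN k hk, hN j hj] with x hx1 hx2
      rw [← sub_sub_sub_cancel_right _ _ (g (t + x))]
      exact (norm_sub_le _ _).trans (by linarith)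
    have H4 : ∀ t : ℝ, ∃ l, Tendsto (fun k => f (t + b (n k))) atTop (𝓝 l) := by
      intro t
      apply cauchySeq_tendsto_of_complete
      rw [Metric.cauchySeq_iff]
      intro ε hε
      obtain ⟨N, hN⟩ := H3 t (ε / 2) (by positivity)
      refine ⟨N, fun k hk j hj => ?_⟩
      have := hN k hk j hj 0 (by simp)
      rw [add_zero] at this
      rw [dist_eq_norm]; linarith
    choose G hG using H4
    have H5 : ∀ t : ℝ, ∀ ε > 0, ∃ N, ∀ k ≥ N, ∀ x ∈ Set.Icc (0:ℝ) 1,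
        ‖f (t + x + b (n k)) - G (t + x)‖ ≤ ε := by
      intro t ε hε
      obtain ⟨N, hN⟩ := H3 t ε hε
      refine ⟨N, fun k hk x hx => ?_⟩
      refine le_of_tendsto (tendsto_const_nhds.sub (hG (t + x))).norm ?_
      filter_upwards [eventually_ge_atTop N] with j hj using hN k hk j hj x hx
    have hloc : TendstoLocallyUniformly (fun k t => f (t + b (n k))) G atTop :=
      aux_locunif fun t ε hε => eventually_atTop.2 (H5 t ε hε)
    have hGc : Continuous G := hloc.continuous (Frequently.of_forall fun k => by fun_prop)
    have H6 : ∀ t : ℝ, ∀ᵐ x ∂(volume.restrict (Set.Icc (0:ℝ) 1)), G (t + x) = g (t + x) := by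
      intro t
      have : ∀ m : ℕ, ∀ᵐ x ∂(volume.restrict (Set.Icc (0:ℝ) 1)),
          ‖G (t + x) - g (t + x)‖ ≤ 2 * (1 / ((m : ℝ) + 1)) := by
        intro m
        have hm : (0:ℝ) < 1 / ((m : ℝ) + 1) := by positivity
        obtain ⟨N, hN⟩ := H1 t _ hm
        obtain ⟨N', hN'⟩ := H5 t _ hm
        filter_upwards [hN (max N N') (le_max_left _ _), ae_restrict_mem measurableSet_Icc]
          with x hx hxI
        have h2 := hN' (max N N') (le_max_right _ _) x hxI
        rw [← sub_sub_sub_cancel_left _ _ (f (t + x + b (n (max N N'))))]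
        exact (norm_sub_le _ _).trans (by linarith)
      filter_upwards [ae_all_iff.2 this] with x hx
      have hlim : Tendsto (fun m : ℕ => 2 * (1 / ((m : ℝ) + 1))) atTop (𝓝 0) := by
        simpa using tendsto_one_div_add_atTop_nhds_zero_nat (𝕜 := ℝ).const_mul 2
      have h0 : ‖G (t + x) - g (t + x)‖ ≤ 0 := ge_of_tendsto' hlim hx
      exact sub_eq_zero.1 (norm_le_zero_iff.1 h0)
    refine ⟨n, hn, G, tendstoLocallyUniformly_iff_forall_isCompact.1 hloc,
      tendstoLocallyUniformly_iff_forall_isCompact.1 (aux_locunif fun t ε hε => ?_)⟩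
    obtain ⟨N, hN⟩ := H2 t ε hε
    refine eventually_atTop.2 ⟨N, fun k hk => aux_everywhere (by fun_prop) ?_⟩
    filter_upwards [hN k hk, H6 (t - b (n k))] with x hx hx'
    rwa [show t + x - b (n k) = t - b (n k) + x by ring, hx']

end
end
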